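/- arXiv:1112.5072 — 8 statements merged into one kernel-verified Lean document; each statement's English description precedes it below -/
import Mathlib

section
/- For every n ≥ 1, the bordered Hankel determinant det(overline{H_n^1(g)}) is ≡ 0 (mod 2) if n is even and ≡ 1 (mod 2) if n is odd, where g is the ruler function g(n) = ν₂(2n). -/
/-- The Hankel matrix `H_n^p(u)` of a sequence `u`: the `n × n` matrix whose
`(i, j)` entry (for `1 ≤ i, j ≤ n`) is `u (p + i + j - 2)`. -/
def hankelMatrix (n p : ℕ) (u : ℕ → ℤ) : Matrix (Fin n) (Fin n) ℤ :=
  Matrix.of fun i j => u (p + i + j)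

/-- The bordered matrix `overline{A}`: the `(n+1) × (n+1)` matrix whose upper-left
`n × n` block is `A`, whose last row and last column have all entries `1`, except
that the bottom-right corner entry is `0`. -/
def border {R : Type*} [Zero R] [One R] {n : ℕ} (A : Matrix (Fin n) (Fin n) R) :
    Matrix (Fin (n + 1)) (Fin (n + 1)) R :=
  Matrix.of fun i j =>
    if hi : (i : ℕ) < n then
      if hj : (j : ℕ) < n then A ⟨i, hi⟩ ⟨j, hj⟩ else 1
    else if (j : ℕ) < n then 1 else 0

/-- The ruler function `g(n) = ν₂(2n)`. -/
def ruler (n : ℕ) : ℤ := (padicValNat 2 (2 * n) : ℤ)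

abbrev F2 := ZMod 2

theorem det_sub2 {m n : Type*} [Fintype m] [DecidableEq m] [Fintype n] [DecidableEq n]
    (M : Matrix m m F2) (e f : n ≃ m) : (M.submatrix e f).det = M.det := by
  have h : M.submatrix e f = (M.submatrix e e).submatrix id (f.trans e.symm) := by
    ext i j; simp
  rw [h, Matrix.det_permute', Matrix.det_submatrix_equiv_self]
  rcases Int.units_eq_one_or (Equiv.Perm.sign (f.trans e.symm)) with h | h <;> rw [h]
  · simp
  · have : (((-1 : ℤˣ) : ℤ) : F2) = 1 := by decide
    rw [this, one_mul]

theorem det_alt {n : ℕ} (M : Matrix (Fin n) (Fin n) F2) (hs : ∀ i j, M i j = M j i)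
    (hd : ∀ i, M i i = 0) (hn : ¬ 2 ∣ n) : M.det = 0 := by
  rw [Matrix.det_apply]
  have hsg : ∀ (σ : Equiv.Perm (Fin n)) (x : F2), Equiv.Perm.sign σ • x = x := by
    intro σ x
    rcases Int.units_eq_one_or (Equiv.Perm.sign σ) with h | h <;> rw [h]
    · simp
    · revert x; decide
  simp only [hsg]
  refine Finset.sum_involution (fun σ _ => σ⁻¹) ?_ ?_ ?_ ?_
  · intro σ _
    have : ∏ i, M (σ⁻¹ i) i = ∏ i, M (σ i) i := by
      rw [← Equiv.prod_comp σ]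
      exact Finset.prod_congr rfl fun i _ => by simp [hs]
    rw [this]; exact CharTwo.add_self_eq_zero _
  · intro σ _ h0 h
    apply h0
    have h2 : σ ^ 2 ^ 1 = 1 := by
      rw [pow_one, pow_two]; nth_rewrite 1 [← h]; simp
    have : Fact (Nat.Prime 2) := ⟨Nat.prime_two⟩
    obtain ⟨a, ha⟩ := Equiv.Perm.exists_fixed_point_of_prime (p := 2) (by simpa using hn) h2
    exact Finset.prod_eq_zero (Finset.mem_univ a) (by rw [ha, hd])
  · intros; simp
  · intros; simp

noncomputable def gam (n : ℕ) : F2 := ((padicValNat 2 (2 * n) : ℤ) : F2)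
theorem gam_odd (k : ℕ) : gam (2*k+1) = 1 := by
  unfold gam
  rw [padicValNat.mul (by norm_num) (by norm_num), padicValNat.eq_zero_of_not_dvd (n := 2*k+1) (by omega)]
  simp
theorem gam_even (k : ℕ) (hk : k ≠ 0) : gam (2*k) = gam k + 1 := by
  unfold gam
  rw [padicValNat.mul (by norm_num) (by omega)]
  simp [add_comm]

noncomputable def HH (k : ℕ) : Matrix (Fin k) (Fin k) F2 := Matrix.of fun i j => gam (1+i+j)
noncomputable def KK (m : ℕ) : Matrix (Fin (m+1)) (Fin (m+1)) F2 :=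
  Matrix.of fun i j => if (j:ℕ) < m then gam (1+i+j) else 1
noncomputable def HJ (k : ℕ) : Matrix (Fin k) (Fin k) F2 := Matrix.of fun i j => gam (1+i+j) + 1
noncomputable def BB (n : ℕ) (c d : F2) : Matrix (Fin (n+1)) (Fin (n+1)) F2 :=
  Matrix.of fun i j => if (i:ℕ) < n then (if (j:ℕ) < n then gam (1+i+j) + c else 1)
    else if (j:ℕ) < n then 1 else d

theorem f2 (x : F2) : x + 1 + 1 = x := by revert x; decide

theorem BB_shift (n : ℕ) : (BB n 1 0).det = (BB n 0 0).det := by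
  refine Matrix.det_eq_of_forall_row_eq_smul_add_const (fun i => if (i:ℕ) < n then 1 else 0) (Fin.last n) (by simp) ?_
  intro i j
  simp only [BB, Matrix.of_apply, Fin.val_last, lt_irrefl, if_false]
  split_ifs <;> simp

theorem gam_diag (i : ℕ) : gam (1 + i + i) = 1 := by
  rw [show 1 + i + i = 2*i+1 by ring, gam_odd]
theorem gam_ee (a b : ℕ) : gam (1 + 2*a + 2*b) = 1 := by
  rw [show 1 + 2*a + 2*b = 2*(a+b)+1 by ring, gam_odd]
theorem gam_oo (a b : ℕ) : gam (1 + (2*a+1) + (2*b+1)) = 1 := by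
  rw [show 1 + (2*a+1) + (2*b+1) = 2*(a+b+1)+1 by ring, gam_odd]
theorem gam_eo (a b : ℕ) : gam (1 + 2*a + (2*b+1)) = gam (1+a+b) + 1 := by
  rw [show 1 + 2*a + (2*b+1) = 2*(1+a+b) by ring, gam_even _ (by omega)]
theorem gam_oe (a b : ℕ) : gam (1 + (2*a+1) + 2*b) = gam (1+a+b) + 1 := by
  rw [show 1 + (2*a+1) + 2*b = 2*(1+a+b) by ring, gam_even _ (by omega)]

theorem one_one : (1 : F2) + 1 = 0 := by decide

theorem BB_even (n : ℕ) (hn : 2 ∣ n) : (BB n 1 0).det = 0 := by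
  apply det_alt
  · intro i j
    simp only [BB, Matrix.of_apply, add_right_comm 1 (i:ℕ) (j:ℕ)]
    split_ifs <;> rfl
  · intro i
    simp only [BB, Matrix.of_apply, gam_diag, one_one]
    split_ifs <;> rfl
  · omega

theorem HJ_odd (n : ℕ) (hn : ¬ 2 ∣ n) : (HJ n).det = 0 := by
  apply det_alt
  · intro i j
    simp only [HJ, Matrix.of_apply, add_right_comm 1 (i:ℕ) (j:ℕ)]
  · intro i
    simp only [HJ, Matrix.of_apply, gam_diag, one_one]
  · omega

noncomputable def eqv (l : ℕ) : Fin l ⊕ Fin l ≃ Fin (2*l) :=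
  Equiv.ofBijective (Sum.elim (fun a => ⟨2*a, by omega⟩) (fun b => ⟨2*b+1, by omega⟩)) (by
    rw [Fintype.bijective_iff_injective_and_card]
    constructor
    · rintro (a|a) (b|b) h <;> simp [Fin.ext_iff] at h ⊢ <;> omega
    · simp; omega)
theorem eqv_l (l : ℕ) (a : Fin l) : ((eqv l (Sum.inl a) : Fin (2*l)) : ℕ) = 2*a := rfl
theorem eqv_r (l : ℕ) (a : Fin l) : ((eqv l (Sum.inr a) : Fin (2*l)) : ℕ) = 2*a+1 := rfl

noncomputable def eqr (l : ℕ) : Fin (l+1) ⊕ Fin l ≃ Fin (2*l+1) :=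
  Equiv.ofBijective (Sum.elim (fun a => ⟨2*a, by omega⟩) (fun b => ⟨2*b+1, by omega⟩)) (by
    rw [Fintype.bijective_iff_injective_and_card]
    constructor
    · rintro (a|a) (b|b) h <;> simp [Fin.ext_iff] at h ⊢ <;> omega
    · simp; omega)
theorem eqr_l (l : ℕ) (a : Fin (l+1)) : ((eqr l (Sum.inl a) : Fin (2*l+1)) : ℕ) = 2*a := rfl
theorem eqr_r (l : ℕ) (a : Fin l) : ((eqr l (Sum.inr a) : Fin (2*l+1)) : ℕ) = 2*a+1 := rfl
noncomputable def eqc (l : ℕ) : Fin (l+1) ⊕ Fin l ≃ Fin (2*l+1) :=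
  Equiv.ofBijective (Sum.elim (fun a => ⟨if (a:ℕ) < l then 2*a+1 else 2*l, by split_ifs <;> omega⟩) (fun b => ⟨2*b, by omega⟩)) (by
    rw [Fintype.bijective_iff_injective_and_card]
    constructor
    · rintro (a|a) (b|b) h <;> simp [Fin.ext_iff] at h ⊢ <;> (try split_ifs at h) <;> omega
    · simp; omega)
theorem eqc_l (l : ℕ) (a : Fin (l+1)) : ((eqc l (Sum.inl a) : Fin (2*l+1)) : ℕ) = if (a:ℕ) < l then 2*(a:ℕ)+1 else 2*l := rfl
theorem eqc_r (l : ℕ) (a : Fin l) : ((eqc l (Sum.inr a) : Fin (2*l+1)) : ℕ) = 2*a := rfl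

theorem HJ_even (l : ℕ) : (HJ (2*l)).det = (HH l).det * (HH l).det := by
  rw [← det_sub2 (HJ (2*l)) (eqv l) ((Equiv.sumComm _ _).trans (eqv l)),
    ← Matrix.det_fromBlocks_zero₂₁ (HH l) 0 (HH l)]
  congr 1
  ext (i|i) (j|j) <;>
  simp [HJ, HH, eqv_l, eqv_r, gam_ee, gam_oo, gam_eo, gam_oe, one_one, f2]

noncomputable def eqw (l : ℕ) : Fin (l+1) ⊕ Fin (l+1) ≃ Fin (2*l+1+1) := eqv (l+1)
theorem eqw_l (l : ℕ) (a : Fin (l+1)) : ((eqw l (Sum.inl a) : Fin (2*l+1+1)) : ℕ) = 2*a := rfl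
theorem eqw_r (l : ℕ) (a : Fin (l+1)) : ((eqw l (Sum.inr a) : Fin (2*l+1+1)) : ℕ) = 2*a+1 := rfl

theorem BB_odd (m : ℕ) : (BB (2*m+1) 1 0).det = (KK m).det * (KK m).det := by
  rw [← det_sub2 (BB (2*m+1) 1 0) (eqw m) ((Equiv.sumComm _ _).trans (eqw m))]
  have ht : (KK m).det * (KK m).det = (KK m).det * (KK m).transpose.det := by
    rw [Matrix.det_transpose]
  rw [ht]
  rw [← Matrix.det_fromBlocks_zero₁₂ (KK m)
    (Matrix.of fun i j => BB (2*m+1) 1 0 (eqw m (Sum.inr i)) (eqw m (Sum.inr j))) (KK m).transpose]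
  congr 1
  ext (i|i) (j|j)
  · have : (i:ℕ) ≤ m := by omega
    by_cases h : (j:ℕ) < m
    · simp [BB, KK, eqw_l, eqw_r, gam_eo, f2, this, h]
    · simp [BB, KK, eqw_l, eqw_r, gam_eo, f2, this, h]
  · have : (i:ℕ) ≤ m := by omega
    have : (j:ℕ) ≤ m := by omega
    simp [BB, eqw_l, gam_ee, one_one, *]
  · simp
  · have : (j:ℕ) ≤ m := by omega
    by_cases h : (i:ℕ) < m
    · simp [BB, KK, eqw_l, eqw_r, gam_oe, f2, this, h, add_right_comm 1 (i:ℕ)]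
    · simp [BB, KK, eqw_l, eqw_r, gam_oe, f2, this, h]

noncomputable def KP (m : ℕ) : Matrix (Fin (m+1)) (Fin (m+1)) F2 :=
  Matrix.of fun i j => if (j:ℕ) < m then gam (1+i+j) + 1 else 1

theorem KP_det (m : ℕ) : (KP m).det = (KK m).det := by
  rw [← Matrix.det_transpose, ← Matrix.det_transpose (KK m)]
  refine Matrix.det_eq_of_forall_row_eq_smul_add_const (fun i => if (i:ℕ) < m then 1 else 0) (Fin.last m) (by simp) ?_
  intro i j
  simp only [KP, KK, Matrix.transpose_apply, Matrix.of_apply, Fin.val_last, lt_irrefl, if_false]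
  split_ifs <;> simp

theorem KP_odd (l : ℕ) : (KP (2*l+1)).det = (KK l).det * (HH (l+1)).det := by
  rw [← det_sub2 (KP (2*l+1)) (eqw l) ((Equiv.sumComm _ _).trans (eqw l))]
  rw [← Matrix.det_fromBlocks_zero₁₂ (KK l)
    (Matrix.of fun i j => KP (2*l+1) (eqw l (Sum.inr i)) (eqw l (Sum.inr j))) (HH (l+1))]
  congr 1
  ext (i|i) (j|j)
  · by_cases h : (j:ℕ) < l
    · simp [KP, KK, eqw_l, eqw_r, gam_eo, f2, h]
    · simp [KP, KK, eqw_l, eqw_r, gam_eo, f2, h]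
  · have : (j:ℕ) ≤ l := by omega
    simp [KP, eqw_l, gam_ee, one_one, *]
  · simp
  · have : (j:ℕ) ≤ l := by omega
    simp [KP, HH, eqw_l, eqw_r, gam_oe, f2, this]

theorem KP_even (l : ℕ) : (KP (2*l)).det = (KK l).det * (HH l).det := by
  rw [← det_sub2 (KP (2*l)) (eqr l) (eqc l)]
  rw [← Matrix.det_fromBlocks_zero₁₂ (KK l)
    (Matrix.of fun i j => KP (2*l) (eqr l (Sum.inr i)) (eqc l (Sum.inl j))) (HH l)]
  congr 1
  ext (i|i) (j|j)
  · by_cases h : (j:ℕ) < l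
    · have : 2 * (j:ℕ) + 1 < 2*l := by omega
      simp [KP, KK, eqr_l, eqc_l, gam_eo, f2, h, this]
    · simp [KP, KK, eqr_l, eqc_l, h]
  · have : 2 * (j:ℕ) < 2*l := by omega
    simp [KP, eqr_l, eqc_r, gam_ee, one_one]
  · simp
  · have : 2 * (j:ℕ) < 2*l := by omega
    simp [KP, HH, eqr_r, eqc_r, gam_oe, f2]

theorem HJ_eq (n : ℕ) : (HJ n).det = (HH n).det + (BB n 0 0).det := by
  let u : Matrix (Fin n) (Fin 1) F2 := Matrix.of fun _ _ => 1
  have hB : (BB n 0 0).det = (Matrix.fromBlocks (HH n) u u.transpose 0).det := by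
    rw [← det_sub2 (BB n 0 0) finSumFinEquiv finSumFinEquiv]
    congr 1
    ext (i|i) (j|j) <;> simp [BB, HH, u]
  have h1 : (HJ n).det = (Matrix.fromBlocks (HH n) u u.transpose 1).det := by
    rw [Matrix.det_fromBlocks_one₂₂]
    congr 1
    ext i j
    simp [HJ, HH, u, Matrix.mul_apply, CharTwo.sub_eq_add]
  have h2 : (HH n).det = (Matrix.fromBlocks (HH n) u 0 1).det := by simp
  rw [hB, h1, h2]
  set X := Matrix.fromBlocks (HH n) u 0 (1 : Matrix (Fin 1) (Fin 1) F2) with hX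
  have e0 : X = X.updateRow (Sum.inr 0) (Sum.elim (fun _ => 0) (fun _ => 1)) := by
    ext (i|i) (j|j) <;> simp [hX, Matrix.updateRow_apply, Fin.fin_one_eq_zero]
  have e1 : Matrix.fromBlocks (HH n) u u.transpose 0 = X.updateRow (Sum.inr 0) (Sum.elim (fun _ => 1) (fun _ => 0)) := by
    ext (i|i) (j|j) <;> simp [hX, u, Matrix.updateRow_apply, Fin.fin_one_eq_zero]
  have e2 : Matrix.fromBlocks (HH n) u u.transpose 1 = X.updateRow (Sum.inr 0) ((Sum.elim (fun _ => 0) (fun _ => 1)) + (Sum.elim (fun _ => 1) (fun _ => 0))) := by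
    ext (i|i) (j|j) <;> simp [hX, u, Matrix.updateRow_apply, Fin.fin_one_eq_zero]
  rw [e2, Matrix.det_updateRow_add, ← e0, ← e1]

theorem main (k : ℕ) : (HH k).det = 1 ∧ (KK k).det = 1 := by
  induction k using Nat.strong_induction_on with
  | _ k ih =>
    have hH : (HH k).det = 1 := by
      have h := HJ_eq k
      rw [← BB_shift] at h
      rcases Nat.even_or_odd' k with ⟨l, rfl | rfl⟩
      · rcases Nat.eq_zero_or_pos l with rfl | hl
        · simp
        rw [HJ_even, BB_even _ (by omega), (ih l (by omega)).1] at h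
        simpa using h.symm
      · rw [HJ_odd _ (by omega), BB_odd, (ih l (by omega)).2] at h
        generalize (HH (2*l+1)).det = x at *
        revert x; decide
    refine ⟨hH, ?_⟩
    rw [← KP_det]
    rcases Nat.even_or_odd' k with ⟨l, rfl | rfl⟩
    · rcases Nat.eq_zero_or_pos l with rfl | hl
      · simp [KP]
      rw [KP_even, (ih l (by omega)).1, (ih l (by omega)).2, one_mul]
    · rw [KP_odd, (ih l (by omega)).2, one_mul]
      rcases Nat.eq_zero_or_pos l with rfl | hl
      · exact hH
      exact (ih (l+1) (by omega)).1

theorem det_cast (n : ℕ) :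
    (((border (hankelMatrix n 1 ruler)).det : ℤ) : F2) = (BB n 0 0).det := by
  rw [Int.cast_det]
  congr 1
  ext i j
  simp only [border, hankelMatrix, ruler, BB, gam, Matrix.map_apply, Matrix.of_apply]
  split_ifs <;> simp

theorem det_border_hankel_ruler_p1_mod_two (n : ℕ) (hn : 1 ≤ n) :
    (Even n → (border (hankelMatrix n 1 ruler)).det ≡ 0 [ZMOD 2]) ∧
    (Odd n → (border (hankelMatrix n 1 ruler)).det ≡ 1 [ZMOD 2]) := by
  constructor
  · intro h
    refine (ZMod.intCast_eq_intCast_iff _ _ 2).1 ?_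
    rw [det_cast, ← BB_shift, BB_even n h.two_dvd]
    simp
  · rintro ⟨m, rfl⟩
    refine (ZMod.intCast_eq_intCast_iff _ _ 2).1 ?_
    rw [det_cast, ← BB_shift, BB_odd, (main m).2]
    simp
end

section
/- For every n ≥ 1, the bordered Hankel determinant det(overline{H_n^2(g)}) is ≡ 0 (mod 2) if n ≡ 0 or 5 (mod 6), and ≡ 1 (mod 2) if n ≡ 1, 2, 3, or 4 (mod 6), where g is the ruler function g(n) = ν₂(2n). -/
open Matrix

namespace RulerAux

def D (n : ℕ) (f : ℕ → ℕ → ZMod 2) : ZMod 2 :=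
  (Matrix.of fun i j : Fin n => f i j).det

def Sp (n a b : ℕ) (r s : ℕ → ℕ) : Prop :=
  (∀ i < a, r i < n) ∧ (∀ i < b, s i < n) ∧ (∀ i < a, ∀ j < a, r i = r j → i = j) ∧
  (∀ i < b, ∀ j < b, s i = s j → i = j) ∧ (∀ i < a, ∀ j < b, r i ≠ s j)

theorem D_congr {n : ℕ} {f f' : ℕ → ℕ → ZMod 2} (h : ∀ i < n, ∀ j < n, f i j = f' i j) :
    D n f = D n f' := by
  unfold D
  congr 1
  ext i j
  exact h i i.2 j j.2

theorem D_tr (n : ℕ) (f : ℕ → ℕ → ZMod 2) : D n (fun i j => f j i) = D n f := by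
  unfold D
  rw [← Matrix.det_transpose]
  rfl

theorem D_zero (f : ℕ → ℕ → ZMod 2) : D 0 f = 1 := by
  simp [D]

theorem D_one (f : ℕ → ℕ → ZMod 2) : D 1 f = f 0 0 := by
  simp [D]

theorem D_row {n : ℕ} {f f' : ℕ → ℕ → ZMod 2} (k : ℕ) (hk : k < n)
    (h1 : ∀ j < n, f k j = f' k j)
    (h : ∀ i < n, i ≠ k → ∀ j < n, f i j = f' i j + f' k j) : D n f = D n f' := by
  unfold D
  refine Matrix.det_eq_of_forall_row_eq_smul_add_const
    (fun i : Fin n => if (i : ℕ) = k then 0 else 1) ⟨k, hk⟩ (by simp) ?_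
  intro i j
  by_cases hi : (i : ℕ) = k
  · simp [hi, h1 j j.2]
  · simp [hi, h i i.2 hi j j.2]

theorem D_add {n : ℕ} {f f1 f2 : ℕ → ℕ → ZMod 2} (k : ℕ) (hk : k < n)
    (h : ∀ j < n, f k j = f1 k j + f2 k j)
    (h1 : ∀ i < n, i ≠ k → ∀ j < n, f1 i j = f i j)
    (h2 : ∀ i < n, i ≠ k → ∀ j < n, f2 i j = f i j) : D n f = D n f1 + D n f2 := by
  unfold D
  have e : (Matrix.of fun i j : Fin n => f i j) =
      (Matrix.of fun i j : Fin n => f i j).updateRow ⟨k, hk⟩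
        ((fun j : Fin n => f1 k j) + (fun j : Fin n => f2 k j)) := by
    ext i j
    by_cases hi : i = ⟨k, hk⟩
    · subst hi; simp [h j j.2]
    · simp [Matrix.updateRow_ne hi]
  rw [e, Matrix.det_updateRow_add]
  congr 2
  · ext i j
    by_cases hi : i = ⟨k, hk⟩
    · subst hi; simp
    · have : (i : ℕ) ≠ k := fun hh => hi (Fin.ext hh)
      simp [Matrix.updateRow_ne hi, h1 i i.2 this j j.2]
  · ext i j
    by_cases hi : i = ⟨k, hk⟩
    · subst hi; simp
    · have : (i : ℕ) ≠ k := fun hh => hi (Fin.ext hh)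
      simp [Matrix.updateRow_ne hi, h2 i i.2 this j j.2]

theorem det_perm {m n : Type*} [Fintype m] [DecidableEq m] [Fintype n] [DecidableEq n]
    (M : Matrix n n (ZMod 2)) (e f : m ≃ n) : (M.submatrix e f).det = M.det := by
  have h : M.submatrix e f = (M.submatrix e e).submatrix id (f.trans e.symm) := by
    ext i j; simp
  rw [h, Matrix.det_permute', Matrix.det_submatrix_equiv_self]
  rcases Int.units_eq_one_or (Equiv.Perm.sign (f.trans e.symm)) with h | h <;> rw [h] <;> simp

theorem sp_equiv {n a b : ℕ} (hn : a + b = n) {r s : ℕ → ℕ} (h : Sp n a b r s) :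
    ∃ e : Fin a ⊕ Fin b ≃ Fin n, (∀ i, (e (Sum.inl i) : ℕ) = r i) ∧
      (∀ i, (e (Sum.inr i) : ℕ) = s i) := by
  obtain ⟨h1, h2, h3, h4, h5⟩ := h
  let φ : Fin a ⊕ Fin b → Fin n :=
    Sum.elim (fun i => ⟨r i, h1 i i.2⟩) (fun i => ⟨s i, h2 i i.2⟩)
  have hi : Function.Injective φ := by
    rintro (x | x) (y | y) hxy
    · have := h3 x x.2 y y.2 (congrArg Fin.val hxy)
      rw [Fin.ext this]
    · exact absurd (congrArg Fin.val hxy) (h5 x x.2 y y.2)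
    · exact absurd (congrArg Fin.val hxy).symm (h5 y y.2 x x.2)
    · have := h4 x x.2 y y.2 (congrArg Fin.val hxy)
      rw [Fin.ext this]
  have hb : Function.Bijective φ :=
    (Fintype.bijective_iff_injective_and_card φ).2 ⟨hi, by simp [hn]⟩
  exact ⟨Equiv.ofBijective φ hb, fun i => rfl, fun i => rfl⟩

theorem D_blk {n a b : ℕ} (hn : a + b = n) {f : ℕ → ℕ → ZMod 2} (fa fb : ℕ → ℕ → ZMod 2)
    (r1 r2 c1 c2 : ℕ → ℕ) (hr : Sp n a b r1 r2) (hc : Sp n a b c1 c2)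
    (h0 : ∀ i < a, ∀ j < b, f (r1 i) (c2 j) = 0)
    (ha : ∀ i < a, ∀ j < a, f (r1 i) (c1 j) = fa i j)
    (hb : ∀ i < b, ∀ j < b, f (r2 i) (c2 j) = fb i j) : D n f = D a fa * D b fb := by
  obtain ⟨e, e1, e2⟩ := sp_equiv hn hr
  obtain ⟨e', e1', e2'⟩ := sp_equiv hn hc
  unfold D
  rw [← det_perm _ e e']
  have : (Matrix.of fun i j : Fin n => f i j).submatrix e e' =
      Matrix.fromBlocks (Matrix.of fun i j : Fin a => fa i j) 0
        (Matrix.of fun (i : Fin b) (j : Fin a) => f (r2 i) (c1 j))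
        (Matrix.of fun i j : Fin b => fb i j) := by
    ext (i | i) (j | j)
    · simp [e1, e1', ha i i.2 j j.2]
    · simp [e1, e2', h0 i i.2 j j.2]
    · simp [e2, e1']
    · simp [e2, e2', hb i i.2 j j.2]
  rw [this, Matrix.det_fromBlocks_zero₁₂]

theorem D_col_zero {n : ℕ} {f : ℕ → ℕ → ZMod 2} (k : ℕ) (hk : k < n)
    (h : ∀ i < n, f i k = 0) : D n f = 0 := by
  unfold D
  exact Matrix.det_eq_zero_of_column_eq_zero ⟨k, hk⟩ (fun i => h i i.2)

def bd (n : ℕ) (f : ℕ → ℕ → ZMod 2) (i j : ℕ) : ZMod 2 :=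
  if i < n then (if j < n then f i j else 1) else (if j < n then 1 else 0)

theorem two0 (x : ZMod 2) : x + x = 0 := CharTwo.add_self_eq_zero x

theorem add11 (x : ZMod 2) : x + 1 + 1 = x := by
  rw [add_assoc, two0, add_zero]

theorem bd_add (n : ℕ) (f : ℕ → ℕ → ZMod 2) :
    D (n + 1) (bd n f) = D (n + 1) (bd n (fun i j => f i j + 1)) := by
  refine D_row n (by omega) ?_ ?_
  · intro j hj; simp [bd]
  · intro i hi hin j hj
    have : i < n := by omega
    by_cases hj' : j < n <;> simp [bd, this, hj', add11]

theorem D_bd (n : ℕ) (f : ℕ → ℕ → ZMod 2) :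
    D n f = D n (fun i j => f i j + 1) + D (n + 1) (bd n f) := by
  have e1 : D (n + 1) (fun i j => if i < n then (if j < n then f i j else 0) else 1) = D n f := by
    rw [D_blk (n := n + 1) (a := n) (b := 1) rfl f (fun _ _ => 1) id (fun _ => n) id (fun _ => n)]
    · simp [D_one]
    all_goals (try unfold Sp)
    all_goals simp +contextual
    all_goals grind
  have e2 : D (n + 1) (fun i j => if i < n then (if j < n then f i j else 0) else 1) =
      D (n + 1) (fun i j => if i < n then (if j < n then f i j + 1 else 1) else 1) := by
    refine D_row n (by omega) ?_ ?_
    · intro j hj; simp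
    · intro i hi hin j hj
      have : i < n := by omega
      by_cases hj' : j < n <;> simp [this, hj', add11, two0]
  have e3 : D (n + 1) (fun i j => if i < n then (if j < n then f i j + 1 else 1) else 1) =
      D (n + 1) (fun i j => if i < n then (if j < n then f i j + 1 else 1)
        else (if j < n then 0 else 1)) + D (n + 1) (bd n (fun i j => f i j + 1)) := by
    refine D_add n (by omega) ?_ ?_ ?_
    · intro j hj
      by_cases hj' : j < n <;> simp [bd, hj']
    · intro i hi hin j hj
      have : i < n := by omega
      simp [this]
    · intro i hi hin j hj
      have : i < n := by omega
      simp [this, bd]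
  have e4 : D (n + 1) (fun i j => if i < n then (if j < n then f i j + 1 else 1)
        else (if j < n then 0 else 1)) = D n (fun i j => f i j + 1) := by
    rw [D_blk (n := n + 1) (a := 1) (b := n) (by omega) (fun _ _ => 1) (fun i j => f i j + 1)
      (fun _ => n) id (fun _ => n) id]
    · simp [D_one]
    all_goals (try unfold Sp)
    all_goals simp +contextual
    all_goals grind
  rw [← e1, e2, e3, e4, ← bd_add]

def g (n : ℕ) : ZMod 2 := ((ruler n : ℤ) : ZMod 2)

theorem ruler_eq {k : ℕ} (hk : 0 < k) : ruler k = 1 + (padicValNat 2 k : ℤ) := by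
  unfold ruler
  rw [padicValNat.mul (by norm_num) (by omega)]
  simp

theorem g_even {k : ℕ} (hk : 0 < k) : g (2 * k) = g k + 1 := by
  unfold g
  rw [ruler_eq (by omega : 0 < 2 * k)]
  unfold ruler
  push_cast
  ring

theorem g_odd (k : ℕ) : g (2 * k + 1) = 1 := by
  unfold g
  rw [ruler_eq (by omega : 0 < 2 * k + 1), padicValNat.eq_zero_of_not_dvd (by omega)]
  simp

def N1 (i j : ℕ) : ZMod 2 := if (i + j) % 2 = 1 then g ((1 + i + j) / 2) else 0
def N2 (i j : ℕ) : ZMod 2 := if (i + j) % 2 = 0 then g (1 + (i + j) / 2) else 0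
def G1 (i j : ℕ) : ZMod 2 := g (1 + i + j)
def G2 (i j : ℕ) : ZMod 2 := g (2 + i + j)
def K (m i j : ℕ) : ZMod 2 := if j < m then g (1 + i + j) else 1

theorem G1_add (i j : ℕ) : G1 i j + 1 = N1 i j := by
  unfold G1 N1
  split_ifs with h
  · obtain ⟨k, hk⟩ : ∃ k, 1 + i + j = 2 * k := ⟨(1 + i + j) / 2, by omega⟩
    rw [hk, g_even (by omega), add11]
    congr 1
    omega
  · obtain ⟨k, hk⟩ : ∃ k, 1 + i + j = 2 * k + 1 := ⟨(1 + i + j) / 2, by omega⟩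
    rw [hk, g_odd, two0]

theorem G2_add (i j : ℕ) : G2 i j + 1 = N2 i j := by
  unfold G2 N2
  split_ifs with h
  · obtain ⟨k, hk⟩ : ∃ k, 2 + i + j = 2 * k := ⟨(2 + i + j) / 2, by omega⟩
    rw [hk, g_even (by omega), add11]
    congr 1
    omega
  · obtain ⟨k, hk⟩ : ∃ k, 2 + i + j = 2 * k + 1 := ⟨(2 + i + j) / 2, by omega⟩
    rw [hk, g_odd, two0]

/-- odd n: unbordered N1 has zero determinant -/
theorem N1_odd (m : ℕ) : D (2 * m + 1) N1 = 0 := by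
  rw [D_blk (n := 2 * m + 1) (a := m + 1) (b := m) (by omega)
    (fun i j => N1 (2 * i) (if j < m then 2 * j + 1 else 2 * m))
    (fun i j => N1 (2 * i + 1) (2 * j))
    (fun i => 2 * i) (fun i => 2 * i + 1) (fun j => if j < m then 2 * j + 1 else 2 * m)
    (fun j => 2 * j)]
  · rw [D_col_zero m (by omega), zero_mul]
    intro i hi
    simp only [N1]
    split_ifs <;> first | rfl | omega
  all_goals (try unfold Sp)
  · grind
  · grind
  · intro i hi j hj
    simp only [N1]
    split_ifs <;> first | rfl | omega
  · intros; rfl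
  · intros; rfl

theorem N1_even (m : ℕ) : D (2 * m) N1 = D m G1 * D m G1 := by
  refine D_blk (n := 2 * m) (a := m) (b := m) (by omega) _ _
    (fun i => 2 * i) (fun i => 2 * i + 1) (fun j => 2 * j + 1) (fun j => 2 * j) ?_ ?_ ?_ ?_ ?_
  all_goals (try unfold Sp)
  · grind
  · grind
  all_goals
    intro i hi j hj
    simp only [N1, G1]
    split_ifs <;> first | rfl | omega | (congr 1; omega)

theorem bN1_odd (m : ℕ) : D (2 * m + 2) (bd (2 * m + 1) N1) = D (m + 1) (K m) * D (m + 1) (K m) := by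
  conv_rhs => rw [← D_tr (m + 1) (K m)]
  conv_rhs => lhs; rw [D_tr (m + 1) (K m)]
  refine D_blk (n := 2 * m + 2) (a := m + 1) (b := m + 1) (by omega) _ _
    (fun i => 2 * i) (fun i => 2 * i + 1) (fun j => 2 * j + 1) (fun j => 2 * j) ?_ ?_ ?_ ?_ ?_
  all_goals (try unfold Sp)
  · grind
  · grind
  all_goals
    intro i hi j hj
    simp only [bd, N1, K]
    split_ifs <;> first | rfl | omega | (congr 1; omega)

theorem bN1_even (m : ℕ) : D (2 * m + 1) (bd (2 * m) N1) = 0 := by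
  rw [D_add (n := 2 * m + 1) (f := bd (2 * m) N1)
    (f1 := fun i j => if i < 2 * m then bd (2 * m) N1 i j
      else if j < 2 * m ∧ j % 2 = 0 then 1 else 0)
    (f2 := fun i j => if i < 2 * m then bd (2 * m) N1 i j
      else if j < 2 * m ∧ j % 2 = 1 then 1 else 0) (2 * m) (by omega)]
  · have : D (2 * m + 1) (fun i j => if i < 2 * m then bd (2 * m) N1 i j
      else if j < 2 * m ∧ j % 2 = 0 then 1 else 0) = D (2 * m + 1)
      (fun i j => if i < 2 * m then bd (2 * m) N1 i j
      else if j < 2 * m ∧ j % 2 = 1 then 1 else 0) := by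
      rw [D_blk (n := 2 * m + 1) (a := 2 * m + 1) (b := 0) (by omega)
        (fun i j => if i < 2 * m then bd (2 * m) N1 i j
          else if j < 2 * m ∧ j % 2 = 1 then 1 else 0) (fun _ _ => 0)
        (fun i => if i = 2 * m then i else if i % 2 = 0 then i + 1 else i - 1) id
        (fun i => if i = 2 * m then i else if i % 2 = 0 then i + 1 else i - 1) id]
      · rw [D_zero, mul_one]
      all_goals (try unfold Sp)
      · grind
      · grind
      · intro i hi j hj; omega
      · intro i hi j hj
        simp only [bd, N1]
        split_ifs <;> first | rfl | omega | (congr 1; omega)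
      · intro i hi j hj; omega
    rw [this, two0]
  · intro j hj
    simp only [bd]
    split_ifs <;> first | omega | simp
  · intro i hi hin j hj
    have : i < 2 * m := by omega
    simp [this]
  · intro i hi hin j hj
    have : i < 2 * m := by omega
    simp [this]

theorem K_rec (b : ℕ) : D (b + 1) (K b) = D (b / 2 + 1) (K (b / 2)) * D ((b + 1) / 2) G1 := by
  have e : D (b + 1) (K b) = D (b + 1) (fun i j => if j < b then N1 i j else 1) := by
    rw [← D_tr, ← D_tr (b + 1) (fun i j => if j < b then N1 i j else 1)]
    refine D_row b (by omega) ?_ ?_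
    · intro j hj; simp [K]
    · intro i hi hib j hj
      have : i < b := by omega
      simp only [K, this, if_true, lt_irrefl, if_false, ← G1_add, add11]
      rfl
  rw [e]
  refine D_blk (n := b + 1) (a := b / 2 + 1) (b := (b + 1) / 2) (by omega) _ _
    (fun i => 2 * i) (fun i => 2 * i + 1) (fun j => if j < b / 2 then 2 * j + 1 else b)
    (fun j => 2 * j) ?_ ?_ ?_ ?_ ?_
  all_goals (try unfold Sp)
  · grind
  · grind
  all_goals
    intro i hi j hj
    simp only [N1, K, G1]
    split_ifs <;> first | rfl | omega | (congr 1; omega)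

theorem G1_split (n : ℕ) : D n G1 = D n N1 + D (n + 1) (bd n N1) := by
  rw [D_bd, bd_add]
  have : (fun i j => G1 i j + 1) = N1 := by ext i j; exact G1_add i j
  rw [this]

theorem all_one (n : ℕ) : D n G1 = 1 ∧ D (n + 1) (K n) = 1 := by
  induction n using Nat.strong_induction_on with
  | _ n ih =>
    have hx : D n G1 = 1 := by
      rcases Nat.even_or_odd' n with ⟨m, rfl | rfl⟩
      · rcases Nat.eq_zero_or_pos m with rfl | hm
        · exact D_zero _
        · rw [G1_split, N1_even, bN1_even, (ih m (by omega)).1]; rfl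
      · rw [G1_split, N1_odd, bN1_odd, (ih m (by omega)).2]; rfl
    refine ⟨hx, ?_⟩
    rcases Nat.eq_zero_or_pos n with rfl | hn
    · simp [D_one, K]
    · rw [K_rec, (ih (n / 2) (by omega)).2]
      rcases Nat.lt_or_ge ((n + 1) / 2) n with h | h
      · rw [(ih _ h).1]; rfl
      · have : (n + 1) / 2 = n := by omega
        rw [this, hx]; rfl

theorem bG1 (n : ℕ) : D (n + 1) (bd n G1) = if n % 2 = 1 then 1 else 0 := by
  have : (fun i j => G1 i j + 1) = N1 := by ext i j; exact G1_add i j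
  rw [bd_add, this]
  rcases Nat.even_or_odd' n with ⟨m, rfl | rfl⟩
  · rw [bN1_even, if_neg (by omega)]
  · rw [bN1_odd, (all_one m).2, if_pos (by omega)]; rfl

theorem N2_det (n : ℕ) : D n N2 = D ((n + 1) / 2) G1 * D (n / 2) G2 := by
  refine D_blk (n := n) (a := (n + 1) / 2) (b := n / 2) (by omega) _ _
    (fun i => 2 * i) (fun i => 2 * i + 1) (fun j => 2 * j) (fun j => 2 * j + 1) ?_ ?_ ?_ ?_ ?_
  all_goals (try unfold Sp)
  · grind
  · grind
  all_goals
    intro i hi j hj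
    simp only [N2, G1, G2]
    split_ifs <;> first | rfl | omega | (congr 1; omega)

theorem bN2_det (n : ℕ) : D (n + 1) (bd n N2) =
    D ((n + 1) / 2 + 1) (bd ((n + 1) / 2) G1) * D (n / 2) G2 +
    D (n / 2 + 1) (bd (n / 2) G2) * D ((n + 1) / 2) G1 := by
  rw [D_add (n := n + 1) (f := bd n N2)
    (f1 := fun i j => if i < n then bd n N2 i j
      else if j < n ∧ j % 2 = 0 then 1 else 0)
    (f2 := fun i j => if i < n then bd n N2 i j
      else if j < n ∧ j % 2 = 1 then 1 else 0) n (by omega)]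
  · congr 1
    · refine D_blk (by omega) _ _
        (fun i => if i < (n + 1) / 2 then 2 * i else n) (fun i => 2 * i + 1)
        (fun i => if i < (n + 1) / 2 then 2 * i else n) (fun i => 2 * i + 1) ?_ ?_ ?_ ?_ ?_
      all_goals (try unfold Sp)
      · grind
      · grind
      all_goals
        intro i hi j hj
        simp only [bd, N2, G1, G2]
        split_ifs <;> first | rfl | omega | (congr 1; omega)
    · refine D_blk (by omega) _ _
        (fun i => if i < n / 2 then 2 * i + 1 else n) (fun i => 2 * i)
        (fun i => if i < n / 2 then 2 * i + 1 else n) (fun i => 2 * i) ?_ ?_ ?_ ?_ ?_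
      all_goals (try unfold Sp)
      · grind
      · grind
      all_goals
        intro i hi j hj
        simp only [bd, N2, G1, G2]
        split_ifs <;> first | rfl | omega | (congr 1; omega)
  · intro j hj
    simp only [bd]
    split_ifs <;> first | omega | simp
  · intro i hi hin j hj
    have : i < n := by omega
    simp [this]
  · intro i hi hin j hj
    have : i < n := by omega
    simp [this]

theorem main (n : ℕ) :
    D n G2 = (if n % 6 = 1 ∨ n % 6 = 4 then 0 else 1) ∧
    D (n + 1) (bd n G2) = (if n % 6 = 0 ∨ n % 6 = 5 then 0 else 1) := by
  induction n using Nat.strong_induction_on with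
  | _ n ih =>
    rcases Nat.eq_zero_or_pos n with rfl | hn
    · simp [D_zero, D_one, bd]
    have hf : (fun i j => G2 i j + 1) = N2 := by ext i j; exact G2_add i j
    obtain ⟨h1, h2⟩ := ih (n / 2) (by omega)
    have hy := bN2_det n
    rw [bG1, (all_one _).1, h1, h2, mul_one] at hy
    have hx := D_bd n G2
    rw [bd_add, hf, N2_det, (all_one _).1, hy, h1, one_mul] at hx
    rw [bd_add, hf, hy, hx]
    have h12 : n % 12 < 12 := Nat.mod_lt _ (by norm_num)
    have a1 : (n + 1) / 2 % 2 = (n % 12 + 1) / 2 % 2 := by omega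
    have a2 : n / 2 % 6 = n % 12 / 2 := by omega
    have a3 : n % 6 = n % 12 % 6 := by omega
    rw [a1, a2, a3]
    generalize n % 12 = t at h12
    clear * - h12
    interval_cases t <;> decide

theorem border_cast (n : ℕ) :
    (((border (hankelMatrix n 2 ruler)).det : ℤ) : ZMod 2) = D (n + 1) (bd n G2) := by
  unfold D
  rw [← eq_intCast (Int.castRingHom (ZMod 2)), RingHom.map_det]
  congr 1
  ext i j
  simp only [border, hankelMatrix, bd, G2, g, RingHom.mapMatrix_apply, Matrix.map_apply,
    Matrix.of_apply]
  split_ifs <;> simp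

end RulerAux

theorem det_border_hankel_ruler_p2_mod_two (n : ℕ) (hn : 1 ≤ n) :
    ((n % 6 = 0 ∨ n % 6 = 5) → (border (hankelMatrix n 2 ruler)).det ≡ 0 [ZMOD 2]) ∧
    ((n % 6 = 1 ∨ n % 6 = 2 ∨ n % 6 = 3 ∨ n % 6 = 4) →
      (border (hankelMatrix n 2 ruler)).det ≡ 1 [ZMOD 2]) := by
  have h := RulerAux.border_cast n
  rw [(RulerAux.main n).2] at h
  constructor
  · intro hh
    rw [if_pos hh] at h
    exact (ZMod.intCast_eq_intCast_iff _ _ 2).1 (by rw [h]; simp)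
  · intro hh
    rw [if_neg (by omega)] at h
    exact (ZMod.intCast_eq_intCast_iff _ _ 2).1 (by rw [h]; simp)
end

section
/- For every n ≥ 1, the bordered Hankel determinant det(overline{H_n^0(g⁰)}) is ≡ 0 (mod 2) if n ≡ 2 or 3 (mod 6), and ≡ 1 (mod 2) if n ≡ 0, 1, 4, or 5 (mod 6), where g⁰ is the ruler function extended by g⁰(0) = 0. -/
/-- The ruler function `g(n) = ν₂(2n)` extended to index `0` by `g⁰(0) = 0`. -/
def ruler0 (n : ℕ) : ℤ := if n = 0 then 0 else (padicValNat 2 (2 * n) : ℤ)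

namespace RulerHankel

def c : ℕ → ℤ → ZMod 2
  | 0, k => if k = 0 then 1 else 0
  | n + 1, k => c n (k - 1) + c n k + c n (k + 1)

lemma two_add (x : ZMod 2) : x + x = 0 := CharTwo.add_self_eq_zero x

lemma c_symm (n : ℕ) : ∀ k, c n (-k) = c n k := by
  induction n with
  | zero => intro k; simp [c]
  | succ n ih =>
    intro k
    have h1 := ih (k + 1)
    have h2 := ih (k - 1)
    have e1 : -k - 1 = -(k + 1) := by ring
    have e2 : -k + 1 = -(k - 1) := by ring
    simp only [c]
    rw [e1, e2, h1, h2, ih k]; ring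

lemma c_two (n : ℕ) (k : ℤ) : c (n + 2) k = c n (k - 2) + c n k + c n (k + 2) := by
  have e1 : k - 1 - 1 = k - 2 := by ring
  have e2 : k - 1 + 1 = k := by ring
  have e3 : k + 1 - 1 = k := by ring
  have e4 : k + 1 + 1 = k + 2 := by ring
  simp only [c, e1, e2, e3, e4]
  linear_combination two_add (c n (k-1)) + two_add (c n k) + two_add (c n (k+1))

lemma c_zero (n : ℕ) : c n 0 = 1 := by
  induction n with
  | zero => simp [c]
  | succ n ih =>
    have := c_symm n 1
    simp only [c, zero_sub, zero_add, this, ih]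
    linear_combination two_add (c n 1)

lemma c_even (n : ℕ) : ∀ k : ℤ, c (2 * n) (2 * k) = c n k ∧ c (2 * n) (2 * k + 1) = 0 := by
  induction n with
  | zero =>
    intro k
    simp only [c, mul_zero]
    constructor
    · by_cases h : k = 0 <;> simp [h]
    · rw [if_neg]; omega
  | succ n ih =>
    intro k
    have e1 : 2 * k - 2 = 2 * (k - 1) := by ring
    have e2 : 2 * k + 2 = 2 * (k + 1) := by ring
    have e3 : 2 * k + 1 - 2 = 2 * (k - 1) + 1 := by ring
    have e4 : 2 * k + 1 + 2 = 2 * (k + 1) + 1 := by ring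
    rw [show 2 * (n + 1) = 2 * n + 2 by ring, c_two, c_two, e1, e2, e3, e4]
    simp [ih, c]

lemma c_supp (n : ℕ) : ∀ k : ℤ, (n : ℤ) < k → c n k = 0 := by
  induction n with
  | zero => intro k hk; simp only [c]; rw [if_neg]; push_cast at hk; omega
  | succ n ih =>
    intro k hk
    push_cast at hk
    simp only [c]
    rw [ih _ (by omega), ih _ (by omega), ih _ (by omega)]; simp

lemma c_diag (n : ℕ) : c n n = 1 := by
  induction n with
  | zero => simp [c]
  | succ n ih =>
    simp only [c]
    push_cast
    rw [add_sub_cancel_right, ih, c_supp _ _ (by omega), c_supp _ _ (by omega)]; simp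

def L (n k : ℕ) : ZMod 2 := c n k + c n (k + 2)

lemma L_supp (n k : ℕ) (h : n < k) : L n k = 0 := by
  unfold L; rw [c_supp _ _ (by omega), c_supp _ _ (by omega)]; simp

lemma L_diag (n : ℕ) : L n n = 1 := by
  unfold L; rw [c_diag, c_supp _ _ (by omega)]; simp

lemma L_zero (n : ℕ) : L (n + 1) 0 = L n 0 + L n 1 := by
  have := c_symm n 1
  simp only [L, c]
  norm_num [this]
  linear_combination two_add (c n 1)

lemma L_succ (n k : ℕ) : L (n + 1) (k + 1) = L n k + L n (k + 1) + L n (k + 2) := by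
  simp only [L, c]
  push_cast
  ring_nf

/-- tridiagonal action -/
def T (f : ℕ → ZMod 2) : ℕ → ZMod 2
  | 0 => f 0 + f 1
  | k + 1 => f k + f (k + 1) + f (k + 2)

lemma L_T (n : ℕ) : L (n + 1) = T (L n) := by
  funext k
  cases k with
  | zero => simp [T, L_zero]
  | succ k => simp [T, L_succ]

lemma T_symm (f g : ℕ → ZMod 2) (R : ℕ) :
    ∑ k ∈ Finset.range (R + 1), T f k * g k + f R * g (R + 1)
      = ∑ k ∈ Finset.range (R + 1), f k * T g k + f (R + 1) * g R := by
  induction R with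
  | zero => simp [T]; ring
  | succ R ih =>
    rw [Finset.sum_range_succ, Finset.sum_range_succ (fun k => f k * T g k)]
    have h1 : ∀ f : ℕ → ZMod 2, T f (R + 1) = f R + f (R + 1) + f (R + 2) := fun _ => rfl
    rw [h1, h1]
    linear_combination ih

lemma L_orth (R h : ℕ) : ∀ m, h < R → ∑ k ∈ Finset.range R, L h k * L m k = L (h + m) 0 := by
  induction h with
  | zero =>
    intro m hR
    obtain ⟨R, rfl⟩ : ∃ r, R = r + 1 := ⟨R - 1, by omega⟩
    rw [Finset.sum_range_succ', Finset.sum_eq_zero]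
    · simp [L_diag]
    · intro k _; rw [L_supp 0 (k+1) (by omega)]; simp
  | succ h ih =>
    intro m hR
    obtain ⟨R, rfl⟩ : ∃ r, R = r + 1 := ⟨R - 1, by omega⟩
    have := T_symm (L h) (L m) R
    rw [L_supp h R (by omega), L_supp h (R+1) (by omega), ← L_T, ← L_T, ih (m+1) (by omega)] at this
    simp only [zero_mul, add_zero] at this
    rw [this]; congr 1; omega

def u (k : ℕ) : ZMod 2 := (ruler0 k : ℤ)

lemma u_succ (m : ℕ) : u (m + 1) = c m 1 + 1 := by
  induction m using Nat.strong_induction_on with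
  | _ m ih =>
    rcases Nat.even_or_odd' m with ⟨t, rfl | rfl⟩
    · have h := (c_even t 0).2
      simp only [mul_zero, zero_add] at h
      rw [h]
      have : padicValNat 2 (2 * (2 * t + 1)) = 1 := by
        rw [padicValNat.mul (by norm_num) (by omega), padicValNat.self (by norm_num),
          padicValNat.eq_zero_of_not_dvd (by omega)]
      simp [u, ruler0, this]
    · have i := ih t (by omega)
      have h1 := (c_even t 0).1
      have h2 := (c_even t 0).2
      have h3 := (c_even t 1).1
      have : padicValNat 2 (2 * (2 * t + 1 + 1)) = 1 + padicValNat 2 (2 * (t + 1)) := by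
        rw [show 2 * t + 1 + 1 = 2 * (t + 1) by ring,
          padicValNat.mul (by norm_num) (by omega), padicValNat.self (by norm_num)]
      have e : u (2 * t + 1 + 1) = 1 + u (t + 1) := by
        simp [u, ruler0, this]
      rw [e, i]
      simp only [mul_zero, zero_add, mul_one] at h1 h2 h3
      simp only [c]
      norm_num [h1, h2, h3, c_zero]
      ring

lemma u_zero : u 0 = 0 := by simp [u, ruler0]

lemma w_zero : u 0 + u 2 = 0 := by
  rw [u_zero, u_succ 1]; decide

lemma w_succ (k : ℕ) : u (k + 1) + u (k + 3) = L k 1 := by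
  rw [u_succ, u_succ (k + 2), c_two]
  have := c_symm k 1
  norm_num [this, L]
  linear_combination two_add (c k 1) + two_add 1

def Lam : ℕ → ℕ → ZMod 2
  | 0, 0 => 1
  | 1, 1 => 1
  | i + 2, k + 2 => L i k
  | _, _ => 0

def X : ℕ → ℕ → ZMod 2
  | 0, _ => 0
  | _, 0 => 0
  | 1, q => if q = 3 then 1 else 0
  | p, 1 => if p = 3 then 1 else 0
  | k + 2, l + 2 => (if l + 1 = k then 1 else 0) + (if l = k + 1 then 1 else 0)
      + (if l + 2 = k then 1 else 0) + (if l = k + 2 then 1 else 0)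
      + (if l = 0 then if k = 0 then 1 else 0 else 0)

def Xact (x : ℕ → ZMod 2) : ℕ → ZMod 2
  | 0 => 0
  | 1 => x 3
  | 2 => x 2 + x 3 + x 4
  | 3 => x 1 + x 2 + x 4 + x 5
  | k + 4 => x (k + 2) + x (k + 3) + x (k + 5) + x (k + 6)

lemma X_act (x : ℕ → ZMod 2) (R p : ℕ) (hx : ∀ q, R + 2 ≤ q → x q = 0) :
    ∑ q ∈ Finset.range (R + 2), X p q * x q = Xact x p := by
  have key : ∀ m, (if m < R then x (m + 2) else 0) = x (m + 2) := by
    intro m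
    split_ifs with h
    · rfl
    · exact (hx _ (by omega)).symm
  rw [Finset.sum_range_succ', Finset.sum_range_succ']
  match p with
  | 0 => simp [X, Xact]
  | 1 =>
    have := key 1
    simpa [X, Xact] using this
  | 2 =>
    have k0 := key 0
    have k1 := key 1
    have k2 := key 2
    simp only [Nat.zero_add] at k0
    simp [X, Xact, add_mul, Finset.sum_add_distrib, k0, k1, k2]
    ring
  | 3 =>
    have k0 := key 0
    have k1 := key 2
    have k2 := key 3
    simp only [Nat.zero_add] at k0
    simp [X, Xact, add_mul, Finset.sum_add_distrib, k0, k1, k2]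
    ring
  | k + 4 =>
    have k0 := key k
    have k1 := key (k + 1)
    have k2 := key (k + 3)
    have k3 := key (k + 4)
    simp [X, Xact, add_mul, Finset.sum_add_distrib, k0, k1, k2, k3]
    ring

/-- difference matrix -/
def Dl (i j : ℕ) : ZMod 2 := (if j = i then 1 else 0) + (if j + 1 = i then 1 else 0)

def pr (f : ℕ → ZMod 2) : ℕ → ZMod 2
  | 0 => 0
  | k + 1 => f k

lemma Dl_sum (f : ℕ → ZMod 2) (n i : ℕ) (h : i < n) :
    ∑ j ∈ Finset.range n, Dl i j * f j = f i + pr f i := by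
  cases i with
  | zero => simp [Dl, add_mul, Finset.sum_add_distrib, pr]; omega
  | succ i =>
    simp [Dl, add_mul, Finset.sum_add_distrib, pr]
    rw [if_pos h, if_pos (by omega)]

def W : ℕ → ℕ → ZMod 2
  | 0, _ => 0
  | _, 0 => 0
  | i + 1, j + 1 => u (i + j) + u (i + j + 2)

lemma Xact_Lam (j : ℕ) (k : ℕ) :
    Xact (Lam (j + 2)) (k + 2) = L (j + 2) k + L (j + 1) k := by
  rw [L_T (j + 1), L_T j]
  match k with
  | 0 =>
    simp [Xact, Lam, T]
    linear_combination -two_add (L j 0) - two_add (L j 1)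
  | 1 =>
    simp [Xact, Lam, T]
    linear_combination -two_add (L j 0) - 2 * two_add (L j 1)- two_add (L j 2)
  | k + 2 =>
    simp [Xact, Lam, T]
    linear_combination -two_add (L j (k+1)) - 2 * two_add (L j (k+2))- two_add (L j (k+3))

lemma Lam_supp (i p : ℕ) (h : i < p) : Lam i p = 0 := by
  match i, p with
  | 0, 0 => omega
  | 0, _ + 1 => simp [Lam]
  | 1, 0 => omega
  | 1, 1 => omega
  | 1, _ + 2 => simp [Lam]
  | i + 2, 0 => omega
  | i + 2, 1 => omega
  | i + 2, k + 2 => simp [Lam]; exact L_supp _ _ (by omega)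

lemma Lam_diag (i : ℕ) : Lam i i = 1 := by
  match i with
  | 0 => rfl
  | 1 => rfl
  | i + 2 => simp [Lam, L_diag]

lemma W_eq (R i j : ℕ) (hi : i < R + 2) (hj : j < R + 2) :
    ∑ p ∈ Finset.range (R + 2), Lam i p * ∑ q ∈ Finset.range (R + 2), X p q * Lam j q
      = W i j := by
  have : ∀ p, ∑ q ∈ Finset.range (R + 2), X p q * Lam j q = Xact (Lam j) p :=
    fun p => X_act _ _ _ (fun q hq => Lam_supp _ _ (by omega))
  simp only [this]
  rw [Finset.sum_range_succ', Finset.sum_range_succ']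
  match i, j with
  | 0, j => simp [Lam, W, Xact]
  | 1, 0 => simp [Lam, W, Xact]
  | 1, 1 => simp [Lam, W, Xact, w_zero]
  | 1, j + 2 =>
    have := w_succ j
    simp [Lam, W, Xact, ← this, add_comm]
  | i + 2, 0 =>
    have : ∀ k, Xact (Lam 0) k = 0 := by
      intro k
      match k with
      | 0 | 1 | 2 | 3 | k + 4 => simp [Xact, Lam]
    simp [this, W]
  | i + 2, 1 =>
    have h : ∀ k, Xact (Lam 1) (k + 2) = if k = 1 then 1 else 0 := by
      intro k
      match k with
      | 0 | 1 | k + 2 => simp [Xact, Lam]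
    have h2 := w_succ i
    simp only [h, Lam, W]
    simp [h2]
    intro h3
    exact (L_supp _ _ (by omega)).symm
  | i + 2, j + 2 =>
    simp only [Xact_Lam, Lam, W]
    simp only [mul_add, Finset.sum_add_distrib]
    rw [L_orth _ _ _ (by omega), L_orth _ _ _ (by omega)]
    have h := L_zero (i + j + 1)
    have h2 := w_succ (i + j + 1)
    rw [show i + 1 + (j + 1) = i + j + 1 + 1 by ring, h2,
      show i + (j + 2) = i + j + 1 + 1 by ring, show i + (j + 1) = i + j + 1 by ring, h]
    simp
    linear_combination two_add (L (i+j+1) 0)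

open Matrix

def mat (n : ℕ) (f : ℕ → ℕ → ZMod 2) : Matrix (Fin n) (Fin n) (ZMod 2) :=
  Matrix.of fun i j => f i j

def col (n : ℕ) (f : ℕ → ZMod 2) : Matrix (Fin n) Unit (ZMod 2) :=
  Matrix.of fun i _ => f i

def e0 (k : ℕ) : ZMod 2 := if k = 0 then 1 else 0

def alpha (k : ℕ) : ZMod 2 := u k + pr u k

lemma det_Lam (n : ℕ) : (mat n Lam).det = 1 := by
  rw [Matrix.det_of_isLowerTriangular]
  · simp [mat, Lam_diag]
  · intro i j h
    exact Lam_supp _ _ h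

lemma det_Dl (n : ℕ) : (mat n Dl).det = 1 := by
  rw [Matrix.det_of_isLowerTriangular]
  · simp [mat, Dl]
  · intro i j h
    have h : (i : ℕ) < j := h
    simp only [mat, of_apply, Dl]
    rw [if_neg (by omega), if_neg (by omega)]; simp

lemma step1 (R : ℕ) :
    fromBlocks (mat (R+2) Lam) 0 0 (1 : Matrix Unit Unit (ZMod 2)) *
      fromBlocks (mat (R+2) X) (col (R+2) e0) (col (R+2) e0)ᵀ 0 *
      (fromBlocks (mat (R+2) Lam) 0 0 1)ᵀ =
      fromBlocks (mat (R+2) W) (col (R+2) e0) (col (R+2) e0)ᵀ 0 := by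
  have hcol : mat (R+2) Lam * col (R+2) e0 = col (R+2) e0 := by
    ext i j
    simp only [mul_apply, mat, col, of_apply]
    rw [Fin.sum_univ_eq_sum_range (fun k => Lam i k * e0 k)]
    simp only [e0, mul_ite, mul_one, mul_zero, Finset.sum_ite_eq']
    simp only [Finset.mem_range, Nat.zero_lt_succ, if_true]
    match (i : ℕ) with
    | 0 | 1 | i + 2 => simp [Lam]
  have hrow := congrArg transpose hcol
  rw [transpose_mul] at hrow
  have hW : mat (R+2) Lam * mat (R+2) X * (mat (R+2) Lam)ᵀ = mat (R+2) W := by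
    rw [Matrix.mul_assoc]
    ext i j
    simp only [mul_apply, mat, of_apply, transpose_apply]
    rw [← W_eq R i j i.2 j.2, ← Fin.sum_univ_eq_sum_range (fun p => Lam i p * _)]
    refine Finset.sum_congr rfl fun p _ => ?_
    rw [← Fin.sum_univ_eq_sum_range (fun q => X p q * Lam j q)]
  simp [fromBlocks_transpose, fromBlocks_multiply, hcol, hrow, hW]

lemma step2 (n : ℕ) :
    fromBlocks (mat n Dl) (col n alpha) 0 (1 : Matrix Unit Unit (ZMod 2)) *
      fromBlocks (mat n fun i j => u (i + j)) (col n 1) (col n 1)ᵀ 0 *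
      (fromBlocks (mat n Dl) (col n alpha) 0 1)ᵀ =
      fromBlocks (mat n W) (col n e0) (col n e0)ᵀ 0 := by
  have hcol : mat n Dl * col n 1 = col n e0 := by
    ext i j
    simp only [mul_apply, mat, col, of_apply]
    rw [Fin.sum_univ_eq_sum_range (fun k => Dl i k * (1 : ℕ → ZMod 2) k), Dl_sum _ _ _ i.2]
    match (i : ℕ) with
    | 0 => simp [pr, e0]
    | i + 1 => simp [pr, e0, two_add]
  have hrow := congrArg transpose hcol
  rw [transpose_mul] at hrow
  have hW : (mat n Dl * (mat n fun i j => u (i + j)) + col n alpha * (col n 1)ᵀ) * (mat n Dl)ᵀ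
      + col n e0 * (col n alpha)ᵀ = mat n W := by
    rw [add_mul, Matrix.mul_assoc (col n alpha), hrow, Matrix.mul_assoc]
    ext i j
    have h1 : ∀ p : ℕ, ∑ q : Fin n, u (p + q) * Dl j q = u (p + j) + pr (fun q => u (p + q)) j := by
      intro p
      rw [← Dl_sum (fun q => u (p + q)) _ _ j.2, ← Fin.sum_univ_eq_sum_range (fun q => Dl j q * u (p + q))]
      exact Finset.sum_congr rfl fun q _ => mul_comm _ _
    simp only [Matrix.add_apply, mul_apply, mat, of_apply, transpose_apply, col, h1]
    rw [Fin.sum_univ_eq_sum_range (fun p => Dl i p * (u (p + j) + pr (fun q => u (p + q)) j)),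
      Dl_sum _ _ _ i.2]
    match (i : ℕ), (j : ℕ) with
    | 0, 0 => simp [pr, e0, alpha, u_zero, W]
    | 0, j + 1 =>
      simp [pr, e0, alpha, W]
      linear_combination two_add (u (j+1)) + two_add (u j)
    | i + 1, 0 =>
      simp [pr, e0, alpha, W]
      linear_combination two_add (u (i+1)) + two_add (u i)
    | i + 1, j + 1 =>
      simp [pr, e0, W]
      rw [show i + 1 + (j + 1) = i + j + 2 by ring, show i + 1 + j = i + j + 1 by ring,
        show i + (j + 1) = i + j + 1 by ring]
      linear_combination two_add (u (i+j+1))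
  simp [fromBlocks_transpose, fromBlocks_multiply, hcol, hrow, hW]

lemma det_eq (R : ℕ) :
    (fromBlocks (mat (R+2) fun i j => u (i + j)) (col (R+2) 1) (col (R+2) 1)ᵀ
      (0 : Matrix Unit Unit (ZMod 2))).det =
    (fromBlocks (mat (R+2) X) (col (R+2) e0) (col (R+2) e0)ᵀ
      (0 : Matrix Unit Unit (ZMod 2))).det := by
  have h1 := congrArg det (step1 R)
  have h2 := congrArg det (step2 (R + 2))
  rw [det_mul, det_mul, det_transpose, det_fromBlocks_zero₂₁, det_Lam] at h1
  rw [det_mul, det_mul, det_transpose, det_fromBlocks_zero₂₁, det_Dl] at h2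
  simp only [det_one, one_mul, mul_one] at h1 h2
  rw [h1, h2]

lemma det_border (n : ℕ) :
    (((border (hankelMatrix n 0 ruler0)).det : ℤ) : ZMod 2) =
    (fromBlocks (mat n fun i j => u (i + j)) (col n 1) (col n 1)ᵀ
      (0 : Matrix Unit Unit (ZMod 2))).det := by
  rw [← eq_intCast (Int.castRingHom (ZMod 2)), RingHom.map_det]
  let e : Fin n ⊕ Unit ≃ Fin (n + 1) :=
    (Equiv.sumCongr (Equiv.refl _) (Equiv.ofUnique Unit (Fin 1))).trans finSumFinEquiv
  rw [← det_submatrix_equiv_self e]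
  congr 1
  ext i j
  rcases i with i | i <;> rcases j with j | j <;>
    simp [e, border, hankelMatrix, mat, col, u]

def trunc (n : ℕ) (v : Fin n → ZMod 2) (k : ℕ) : ZMod 2 := if h : k < n then v ⟨k, h⟩ else 0

lemma mulVec_row (R : ℕ) (x : ℕ → ZMod 2) (hx : ∀ q, R + 2 ≤ q → x q = 0) (y : ZMod 2)
    (i : Fin (R + 2)) :
    (fromBlocks (mat (R+2) X) (col (R+2) e0) (col (R+2) e0)ᵀ
      (0 : Matrix Unit Unit (ZMod 2)) *ᵥ (Sum.elim (fun k => x k) (fun _ => y))) (Sum.inl i)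
      = Xact x i + e0 i * y := by
  rw [← X_act x R i hx, ← Fin.sum_univ_eq_sum_range (fun q => X i q * x q)]
  simp [mulVec, dotProduct, mat, col]

lemma mulVec_last (R : ℕ) (x : ℕ → ZMod 2) (y : ZMod 2) :
    (fromBlocks (mat (R+2) X) (col (R+2) e0) (col (R+2) e0)ᵀ
      (0 : Matrix Unit Unit (ZMod 2)) *ᵥ (Sum.elim (fun k => x k) (fun _ => y))) (Sum.inr ())
      = x 0 := by
  simp [mulVec, dotProduct, col]
  rw [Fin.sum_univ_eq_sum_range (fun q => e0 q * x q)]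
  simp [e0]

/-- the periodic solution -/
def per (a b : ZMod 2) (k : ℕ) : ZMod 2 :=
  if k % 6 = 0 then a + b else if k % 6 = 1 then b else if k % 6 = 2 then a
  else if k % 6 = 3 then 0 else if k % 6 = 4 then a else b

lemma per_rec (a b : ZMod 2) (k : ℕ) :
    per a b (k + 4) = per a b k + per a b (k + 1) + per a b (k + 3) := by
  have h : k % 6 < 6 := Nat.mod_lt _ (by norm_num)
  simp only [per, Nat.add_mod k]
  generalize k % 6 = r at h
  revert a b
  interval_cases r <;> decide

def sol (a b : ZMod 2) (k : ℕ) : ZMod 2 := if k = 0 then 0 else per a b k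

lemma sol_ker (a b : ZMod 2) (p : ℕ) : Xact (sol a b) p = 0 := by
  match p with
  | 0 => rfl
  | 1 => simp [Xact, sol, per]
  | 2 => simp [Xact, sol, per, two_add]
  | 3 =>
    simp [Xact, sol, per]
    linear_combination two_add a + two_add b
  | k + 4 =>
    have := per_rec a b (k + 2)
    simp [Xact, sol]
    rw [show k + 6 = k + 2 + 4 by ring, this]
    linear_combination two_add (per a b (k+2)) + two_add (per a b (k+3)) + two_add (per a b (k+5))

lemma Xact_congr (x y : ℕ → ZMod 2) (p : ℕ) (h : ∀ k, k ≤ p + 2 → x k = y k) :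
    Xact x p = Xact y p := by
  match p with
  | 0 => rfl
  | 1 | 2 | 3 | k + 4 =>
    simp only [Xact]
    simp (disch := omega) only [h]

lemma singular (R : ℕ) (h : (R + 2) % 6 = 2 ∨ (R + 2) % 6 = 3) :
    (fromBlocks (mat (R+2) X) (col (R+2) e0) (col (R+2) e0)ᵀ
      (0 : Matrix Unit Unit (ZMod 2))).det = 0 := by
  let x : ℕ → ZMod 2 := fun k => if k < R + 2 then sol 0 1 k else 0
  have hx : ∀ q, R + 2 ≤ q → x q = 0 := fun q hq => if_neg (by omega)
  rw [← exists_mulVec_eq_zero_iff]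
  refine ⟨Sum.elim (fun k => x k) (fun _ => 0), ?_, ?_⟩
  · intro h0
    have := congrFun h0 (Sum.inl 1)
    simp [x, sol, per] at this
  · funext i
    rcases i with i | i
    · rw [mulVec_row R x hx]
      have : Xact x i = Xact (sol 0 1) i := by
        apply Xact_congr
        intro k hk
        have := i.2
        by_cases hk2 : k < R + 2
        · simp [x, hk2]
        · have : k = R + 2 ∨ k = R + 3 := by omega
          have h6 : k % 6 = 2 ∨ k % 6 = 3 ∨ k % 6 = 4 := by omega
          rw [hx k (by omega), sol, if_neg (by omega), per]
          rcases h6 with h6 | h6 | h6 <;> simp [h6]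
      rw [this, sol_ker]; simp
    · rw [mulVec_last]; simp [x, sol]

lemma per_zero (a b : ZMod 2) (n : ℕ) (h : n % 6 = 0 ∨ n % 6 = 1 ∨ n % 6 = 4 ∨ n % 6 = 5)
    (h2 : per a b n = 0) (h3 : per a b (n + 1) = 0) : a = 0 ∧ b = 0 := by
  simp only [per, Nat.add_mod n] at h2 h3
  revert a b
  rcases h with h | h | h | h <;> rw [h] <;> decide

lemma nonsingular (R : ℕ) (h : (R + 2) % 6 = 0 ∨ (R + 2) % 6 = 1 ∨ (R + 2) % 6 = 4 ∨
      (R + 2) % 6 = 5) :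
    (fromBlocks (mat (R+2) X) (col (R+2) e0) (col (R+2) e0)ᵀ
      (0 : Matrix Unit Unit (ZMod 2))).det ≠ 0 := by
  intro hdet
  rw [← exists_mulVec_eq_zero_iff] at hdet
  obtain ⟨v, hv, hM⟩ := hdet
  let x : ℕ → ZMod 2 := trunc (R + 2) (fun k => v (Sum.inl k))
  have hx : ∀ q, R + 2 ≤ q → x q = 0 := fun q hq => dif_neg (by omega)
  have hve : v = Sum.elim (fun k : Fin (R + 2) => x k) (fun _ => v (Sum.inr ())) := by
    funext i
    rcases i with i | i
    · simp [x, trunc]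
    · rfl
  have hrow : ∀ p, p < R + 2 → Xact x p + e0 p * v (Sum.inr ()) = 0 := by
    intro p hp
    rw [← mulVec_row R x hx _ ⟨p, hp⟩, ← hve, hM]; rfl
  have hx0 : x 0 = 0 := by
    rw [← mulVec_last R x (v (Sum.inr ())), ← hve, hM]; rfl
  have hy : v (Sum.inr ()) = 0 := by
    have := hrow 0 (by omega)
    simpa [Xact, e0] using this
  have hrow2 : ∀ p, p < R + 2 → Xact x p = 0 := by
    intro p hp
    have := hrow p hp
    simpa [hy] using this
  have hper : ∀ k, 1 ≤ k → k ≤ R + 3 → x k = per (x 2) (x 1) k := by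
    intro k
    induction k using Nat.strong_induction_on with
    | _ k ih =>
      intro hk1 hk2
      match k with
      | 0 => omega
      | 1 => simp [per]
      | 2 => simp [per]
      | 3 => simpa [per, Xact] using hrow2 1 (by omega)
      | 4 =>
        have h3 := hrow2 1 (by omega)
        have h4 := hrow2 2 (by omega)
        simp only [Xact] at h3 h4
        simp [per]
        linear_combination h4 - h3 - two_add (x 2)
      | 5 =>
        have h3 := hrow2 1 (by omega)
        have h4 := hrow2 2 (by omega)
        have h5 := hrow2 3 (by omega)
        simp only [Xact] at h3 h4 h5
        simp [per]
        linear_combination h5 - h4 + h3 - two_add (x 1)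
      | k + 6 =>
        have h6 := hrow2 (k + 4) (by omega)
        simp only [Xact] at h6
        have := per_rec (x 2) (x 1) (k + 2)
        rw [show k + 2 + 4 = k + 6 by ring, ← ih (k + 2) (by omega) (by omega) (by omega),
          ← ih (k + 2 + 1) (by omega) (by omega) (by omega),
          ← ih (k + 2 + 3) (by omega) (by omega) (by omega)] at this
        rw [this]
        linear_combination h6 - two_add (x (k+2)) - two_add (x (k+3)) - two_add (x (k+5))
  have ha := hper (R + 2) (by omega) (by omega)
  have hb := hper (R + 3) (by omega) (by omega)
  rw [hx _ (by omega)] at ha hb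
  obtain ⟨h2, h1⟩ := per_zero _ _ _ h ha.symm hb.symm
  apply hv
  rw [hve]
  funext i
  rcases i with i | i
  · simp only [Sum.elim_inl, Pi.zero_apply]
    rcases Nat.eq_zero_or_pos (i : ℕ) with h0 | h0
    · rw [h0, hx0]
    · rw [hper _ h0 (by omega), h1, h2]; simp [per]
  · simpa using hy

end RulerHankel

theorem det_border_hankel_ruler0_mod_two (n : ℕ) (hn : 1 ≤ n) :
    ((n % 6 = 2 ∨ n % 6 = 3) → (border (hankelMatrix n 0 ruler0)).det ≡ 0 [ZMOD 2]) ∧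
    ((n % 6 = 0 ∨ n % 6 = 1 ∨ n % 6 = 4 ∨ n % 6 = 5) →
      (border (hankelMatrix n 0 ruler0)).det ≡ 1 [ZMOD 2]) := by
  have hz : ∀ z a : ℤ, z ≡ a [ZMOD 2] ↔ (z : ZMod 2) = (a : ZMod 2) := fun z a =>
    (ZMod.intCast_eq_intCast_iff z a 2).symm
  rcases Nat.lt_or_ge n 2 with h1 | h1
  · obtain rfl : n = 1 := by omega
    refine ⟨fun h => by omega, fun _ => ?_⟩
    rw [Matrix.det_fin_two]
    simp [border, hankelMatrix]
    decide
  · obtain ⟨R, rfl⟩ : ∃ R, n = R + 2 := ⟨n - 2, by omega⟩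
    rw [hz, hz, RulerHankel.det_border, RulerHankel.det_eq]
    refine ⟨fun h => ?_, fun h => ?_⟩
    · simpa using RulerHankel.singular R h
    · have := RulerHankel.nonsingular R h
      have two : ∀ d : ZMod 2, d ≠ 0 → d = 1 := by decide
      simpa using two _ this
end

section
/- Let A be an m×m matrix and B an n×n matrix over a commutative ring, and let a, b, x, y be scalars. Then the determinant of the (m+n)×(m+n) block matrix [[aA, y·J_{m×n}], [x·J_{n×m}, bB]] equals a^m b^n det(A) det(B) − x y a^{m−1} b^{n−1} det(overline{A}) det(overline{B}), where J_{m×n} is the m×n all-ones matrix. -/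
/-- The `m × n` all-ones matrix `J_{m×n}`. -/
def allOnes (R : Type*) [One R] (m n : ℕ) : Matrix (Fin m) (Fin n) R :=
  Matrix.of fun _ _ => 1

open Matrix in
theorem aux_schur {R : Type*} [CommRing R] {m n : ℕ}
    (A : Matrix (Fin m) (Fin m) R) (U : Matrix (Fin m) (Fin n) R)
    (V : Matrix (Fin n) (Fin m) R) (D : Matrix (Fin n) (Fin n) R) :
    (fromBlocks A U V D).det * A.det ^ (m + n) =
      A.det ^ (m + 1) * (A.det • D - V * A.adjugate * U).det := by
  have h : fromBlocks A U V D * fromBlocks A.adjugate (-(A.adjugate * U)) 0 (A.det • 1) =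
      fromBlocks (A.det • 1) 0 (V * A.adjugate) (A.det • D - V * A.adjugate * U) := by
    rw [fromBlocks_multiply]
    congr 1
    · simp [mul_adjugate]
    · rw [Matrix.mul_neg, ← Matrix.mul_assoc, mul_adjugate]; simp
    · simp
    · rw [Matrix.mul_neg, ← Matrix.mul_assoc]; simp [sub_eq_neg_add]
  have h2 := congrArg det h
  rw [det_mul, det_fromBlocks_zero₂₁, det_fromBlocks_zero₁₂, det_smul, det_smul] at h2
  have h3 : A.det * A.adjugate.det = A.det ^ m := by
    rw [← det_mul, mul_adjugate, det_smul]; simp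
  simp only [Fintype.card_fin, det_one, mul_one] at h2
  calc _ = (fromBlocks A U V D).det * (A.det ^ m * A.det ^ n) := by rw [pow_add]
    _ = A.det * ((fromBlocks A U V D).det * (A.adjugate.det * A.det ^ n)) := by
      rw [← h3]; ring
    _ = _ := by rw [h2]; ring

/-- sum of the entries of the adjugate -/
def adjSum {R : Type*} [CommRing R] {m : ℕ} (A : Matrix (Fin m) (Fin m) R) : R :=
  ∑ i, ∑ j, A.adjugate i j

theorem adjSum_mul {R : Type*} [CommRing R] {m n k : ℕ} (A : Matrix (Fin m) (Fin m) R) :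
    allOnes R n m * A.adjugate * allOnes R m k = adjSum A • allOnes R n k := by
  ext i j
  simp only [Matrix.mul_apply, allOnes, Matrix.of_apply, one_mul, mul_one, Matrix.smul_apply,
    smul_eq_mul, adjSum]
  rw [Finset.sum_comm]

theorem adjSum_smul {R : Type*} [CommRing R] {m : ℕ} (a : R) (A : Matrix (Fin m) (Fin m) R) :
    adjSum (a • A) = a ^ (m - 1) * adjSum A := by
  simp [adjSum, Matrix.adjugate_smul, Finset.mul_sum]

theorem adjSum_map {R S : Type*} [CommRing R] [CommRing S] (f : R →+* S) {m : ℕ}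
    (A : Matrix (Fin m) (Fin m) R) : f (adjSum A) = adjSum (f.mapMatrix A) := by
  rw [adjSum, adjSum, ← RingHom.map_adjugate]
  simp

theorem allOnes_map {R S : Type*} [CommRing R] [CommRing S] (f : R →+* S) (m n : ℕ) :
    (allOnes R m n).map f = allOnes S m n := by
  ext; simp [allOnes]

theorem exists_reg {R : Type*} [CommRing R] {m : ℕ} (A : Matrix (Fin m) (Fin m) R) :
    ∃ A' : Matrix (Fin m) (Fin m) (Polynomial R), IsRegular A'.det ∧
      A'.map (Polynomial.evalRingHom 0) = A := by
  refine ⟨A.map Polynomial.C + (Polynomial.X : Polynomial R) • 1, ?_, ?_⟩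
  · refine Polynomial.Monic.isRegular ?_
    simp only [Polynomial.Monic.def, ← Polynomial.leadingCoeff_det_X_one_add_C A, add_comm]
  · ext
    simp

open Matrix in
theorem bord_reg {R : Type*} [CommRing R] {m : ℕ} (A : Matrix (Fin m) (Fin m) R)
    (hA : IsRegular A.det) :
    (fromBlocks A (allOnes R m 1) (allOnes R 1 m) 0).det = - adjSum A := by
  have h := aux_schur A (allOnes R m 1) (allOnes R 1 m) 0
  rw [adjSum_mul] at h
  apply (hA.pow (m + 1)).right
  simp only
  rw [h]
  simp [allOnes, mul_comm]

open Matrix in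
theorem bord {R : Type*} [CommRing R] {m : ℕ} (A : Matrix (Fin m) (Fin m) R) :
    (fromBlocks A (allOnes R m 1) (allOnes R 1 m) 0).det = - adjSum A := by
  obtain ⟨A', h, rfl⟩ := exists_reg A
  have := congrArg (Polynomial.evalRingHom (0 : R)) (bord_reg A' h)
  rw [RingHom.map_det, map_neg, adjSum_map, RingHom.mapMatrix_apply, RingHom.mapMatrix_apply,
    fromBlocks_map, allOnes_map, allOnes_map] at this
  rw [← this, Matrix.map_zero _ (map_zero _)]

open Matrix in
theorem det_sub_J {R : Type*} [CommRing R] {m : ℕ} (A : Matrix (Fin m) (Fin m) R) (t : R) :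
    (A - t • allOnes R m m).det = A.det - t * adjSum A := by
  have h1 : t • allOnes R m m = allOnes R m 1 * (t • allOnes R 1 m) := by
    ext i j; simp [allOnes, Matrix.mul_apply]
  let p : Fin m ⊕ Fin 1 → R := Sum.elim (fun _ => 0) (fun _ => 1)
  let q : Fin m ⊕ Fin 1 → R := Sum.elim (fun _ => 1) (fun _ => 0)
  have h2 : fromBlocks A (allOnes R m 1) (t • allOnes R 1 m) 1 =
      (fromBlocks A (allOnes R m 1) 0 (1 : Matrix (Fin 1) (Fin 1) R)).updateRow (Sum.inr 0)
        (p + t • q) := by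
    ext i j
    rcases i with i | i <;> rcases j with j | j <;>
      simp [allOnes, updateRow_apply, p, q, Matrix.one_apply, eq_iff_true_of_subsingleton]
  have h3 : (fromBlocks A (allOnes R m 1) 0 (1 : Matrix (Fin 1) (Fin 1) R)).updateRow (Sum.inr 0) p =
      fromBlocks A (allOnes R m 1) 0 1 := by
    ext i j
    rcases i with i | i <;> rcases j with j | j <;>
      simp [allOnes, updateRow_apply, p, q, Matrix.one_apply, eq_iff_true_of_subsingleton]
  have h4 : (fromBlocks A (allOnes R m 1) 0 (1 : Matrix (Fin 1) (Fin 1) R)).updateRow (Sum.inr 0) q =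
      fromBlocks A (allOnes R m 1) (allOnes R 1 m) 0 := by
    ext i j
    rcases i with i | i <;> rcases j with j | j <;>
      simp [allOnes, updateRow_apply, p, q, Matrix.one_apply, eq_iff_true_of_subsingleton]
  rw [h1, ← det_fromBlocks_one₂₂, h2, det_updateRow_add, det_updateRow_smul, h3, h4, bord,
    det_fromBlocks_zero₂₁, det_one]
  ring

open Matrix in
theorem main_reg {R : Type*} [CommRing R] {m n : ℕ} (A : Matrix (Fin m) (Fin m) R)
    (B : Matrix (Fin n) (Fin n) R) (x y : R) (hA : IsRegular A.det) :
    (fromBlocks A (y • allOnes R m n) (x • allOnes R n m) B).det =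
      A.det * B.det - x * y * adjSum A * adjSum B := by
  have h := aux_schur A (y • allOnes R m n) (x • allOnes R n m) B
  have e : (x • allOnes R n m) * A.adjugate * (y • allOnes R m n) =
      (x * y * adjSum A) • allOnes R n n := by
    rw [Matrix.smul_mul, Matrix.smul_mul, Matrix.mul_smul, adjSum_mul, smul_smul, smul_smul]
  rw [e, det_sub_J, adjSum_smul, det_smul, Fintype.card_fin] at h
  apply (hA.pow (m + n)).right
  simp only
  rw [h]
  rcases n with _ | n
  · simp [adjSum]; ring
  · simp only [Nat.add_sub_cancel]; ring

open Matrix in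
theorem main_gen {R : Type*} [CommRing R] {m n : ℕ} (A : Matrix (Fin m) (Fin m) R)
    (B : Matrix (Fin n) (Fin n) R) (x y : R) :
    (fromBlocks A (y • allOnes R m n) (x • allOnes R n m) B).det =
      A.det * B.det - x * y * adjSum A * adjSum B := by
  obtain ⟨A', h, rfl⟩ := exists_reg A
  have := congrArg (Polynomial.evalRingHom (0 : R))
    (main_reg A' (B.map Polynomial.C) (Polynomial.C x) (Polynomial.C y) h)
  have hB : (B.map Polynomial.C).map (Polynomial.evalRingHom (0 : R)) = B := by
    ext; simp
  have hJ : ∀ (z : R) (k l : ℕ), (Polynomial.C z • allOnes (Polynomial R) k l).map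
      (Polynomial.evalRingHom (0 : R)) = z • allOnes R k l := by
    intros; ext; simp [allOnes]
  have hC : ∀ z : R, Polynomial.evalRingHom (0 : R) (Polynomial.C z) = z := by simp
  simp only [map_sub, map_mul, RingHom.map_det, adjSum_map, RingHom.mapMatrix_apply,
    fromBlocks_map, hB, hJ, hC] at this
  exact this

open Matrix in
theorem det_border {R : Type*} [CommRing R] {m : ℕ} (A : Matrix (Fin m) (Fin m) R) :
    (border A).det = - adjSum A := by
  rw [← bord, ← det_submatrix_equiv_self finSumFinEquiv (border A)]
  congr 1
  ext i j
  rcases i with i | i <;> rcases j with j | j <;> simp [allOnes, border]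

theorem det_two_by_two_block {R : Type*} [CommRing R] {m n : ℕ}
    (A : Matrix (Fin m) (Fin m) R) (B : Matrix (Fin n) (Fin n) R) (a b x y : R) :
    (Matrix.fromBlocks (a • A) (y • allOnes R m n) (x • allOnes R n m) (b • B)).det =
      a ^ m * b ^ n * A.det * B.det -
        x * y * a ^ (m - 1) * b ^ (n - 1) * (border A).det * (border B).det := by
  rw [main_gen, det_border, det_border, adjSum_smul, adjSum_smul, Matrix.det_smul, Matrix.det_smul,
    Fintype.card_fin, Fintype.card_fin]
  ring
end

section
/- Let A, B, C be square matrices of sizes m×m, n×n, p×p over a commutative ring, and let a, b, c be scalars. Then the determinant of the (m+n+p)×(m+n+p) block matrix [[A, c·J_{m×n}, b·J_{m×p}], [c·J_{n×m}, B, a·J_{n×p}], [b·J_{p×m}, a·J_{p×n}, C]] equals det(A)det(B)det(C) − a² det(A)det(overline{B})det(overline{C}) − b² det(overline{A})det(B)det(overline{C}) − c² det(overline{A})det(overline{B})det(C) − 2abc·det(overline{A})det(overline{B})det(overline{C}). -/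
/-- The `3 × 3` block matrix `[[A, c·J], [c·J, B, a·J], [b·J, a·J, C]]` appearing in
Lemma 1.3 of Allouche–Peyrière–Wen–Wen, where the off-diagonal blocks are constant
matrices with the indicated entries. -/
def threeBlocks {R : Type*} {m n p : ℕ}
    (A : Matrix (Fin m) (Fin m) R) (B : Matrix (Fin n) (Fin n) R)
    (C : Matrix (Fin p) (Fin p) R) (a b c : R) :
    Matrix (Fin m ⊕ (Fin n ⊕ Fin p)) (Fin m ⊕ (Fin n ⊕ Fin p)) R :=
  Matrix.of fun i j =>
    match i, j with
    | .inl i, .inl j => A i j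
    | .inl _, .inr (.inl _) => c
    | .inl _, .inr (.inr _) => b
    | .inr (.inl _), .inl _ => c
    | .inr (.inl i), .inr (.inl j) => B i j
    | .inr (.inl _), .inr (.inr _) => a
    | .inr (.inr _), .inl _ => b
    | .inr (.inr _), .inr (.inl _) => a
    | .inr (.inr i), .inr (.inr j) => C i j

open Matrix in
theorem border_eq_aux {R : Type*} [CommRing R] {n : ℕ} (A : Matrix (Fin n) (Fin n) R) :
    (border A).submatrix finSumFinEquiv finSumFinEquiv =
      fromBlocks A (Matrix.of fun _ _ => 1) (Matrix.of fun _ _ => 1)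
        (0 : Matrix (Fin 1) (Fin 1) R) := by
  ext i j
  rcases i with i | i <;> rcases j with j | j <;> simp [border]

open Matrix in
theorem det_border_aux {R : Type*} [CommRing R] {n : ℕ} (A : Matrix (Fin n) (Fin n) R)
    (u : Fin n → R) (hu : ∀ i, ∑ j, A i j * u j = 1) :
    (border A).det = - (A.det * ∑ i, u i) := by
  rw [← det_submatrix_equiv_self finSumFinEquiv, border_eq_aux]
  have h : fromBlocks A (Matrix.of fun _ _ => 1) (Matrix.of fun _ _ => 1)
        (0 : Matrix (Fin 1) (Fin 1) R) *
        fromBlocks 1 (Matrix.of fun i _ => - u i) 0 1 =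
      fromBlocks A 0 (Matrix.of fun _ _ => 1) (Matrix.of fun _ _ => - ∑ i, u i) := by
    rw [fromBlocks_multiply]
    congr 1
    · simp
    · ext i j
      simp [Matrix.mul_apply, hu]
    · simp
    · ext i j
      simp [Matrix.mul_apply]
  have h2 := congrArg det h
  rw [det_mul, det_fromBlocks_zero₂₁, det_fromBlocks_zero₁₂] at h2
  simpa using h2

open Matrix in
theorem det_three_aux {R : Type*} [CommRing R] {m n p : ℕ}
    (A : Matrix (Fin m) (Fin m) R) (B : Matrix (Fin n) (Fin n) R)
    (C : Matrix (Fin p) (Fin p) R) (a b c : R)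
    (u : Fin m → R) (hu : ∀ i, ∑ j, A i j * u j = 1)
    (v : Fin n → R) (hv : ∀ i, ∑ j, B i j * v j = 1)
    (w : Fin p → R) (hw : ∀ i, ∑ j, C i j * w j = 1) :
    (threeBlocks A B C a b c).det =
      A.det * B.det * C.det
        - a ^ 2 * (A.det * (border B).det * (border C).det)
        - b ^ 2 * ((border A).det * B.det * (border C).det)
        - c ^ 2 * ((border A).det * (border B).det * C.det)
        - 2 * a * b * c * ((border A).det * (border B).det * (border C).det) := by
  rw [det_border_aux A u hu, det_border_aux B v hv, det_border_aux C w hw]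
  let D : Matrix (Fin m ⊕ (Fin n ⊕ Fin p)) (Fin m ⊕ (Fin n ⊕ Fin p)) R :=
    fromBlocks A 0 0 (fromBlocks B 0 0 C)
  let W : Matrix (Fin m ⊕ (Fin n ⊕ Fin p)) (Fin 3) R :=
    Matrix.of (Sum.elim (fun i => ![u i, 0, 0])
      (Sum.elim (fun i => ![0, v i, 0]) (fun i => ![0, 0, w i])))
  let V : Matrix (Fin 3) (Fin m ⊕ (Fin n ⊕ Fin p)) R :=
    (Matrix.of (Sum.elim (fun _ => ![0, c, b])
      (Sum.elim (fun _ => ![c, 0, a]) (fun _ => ![b, a, 0]))))ᵀ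
  let U : Matrix (Fin m ⊕ (Fin n ⊕ Fin p)) (Fin 3) R :=
    Matrix.of (Sum.elim (fun _ => ![1, 0, 0])
      (Sum.elim (fun _ => ![0, 1, 0]) (fun _ => ![0, 0, 1])))
  have hDW : D * W = U := by
    ext i k
    rcases i with i | i | i <;> fin_cases k <;>
      simp [D, W, U, Matrix.mul_apply, hu, hv, hw]
  have hM : threeBlocks A B C a b c = D * (1 + W * V) := by
    rw [Matrix.mul_add, ← Matrix.mul_assoc, hDW, Matrix.mul_one]
    ext i j
    rcases i with i | i | i <;> rcases j with j | j | j <;>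
      simp [D, V, U, Matrix.mul_apply, threeBlocks, Fin.sum_univ_three]
  have hVW : V * W = !![0, c * ∑ i, v i, b * ∑ i, w i;
      c * ∑ i, u i, 0, a * ∑ i, w i; b * ∑ i, u i, a * ∑ i, v i, 0] := by
    ext i j
    fin_cases i <;> fin_cases j <;>
      simp [V, W, Matrix.mul_apply, Finset.mul_sum]
  rw [hM, det_mul, det_one_add_mul_comm, hVW, det_fromBlocks_zero₂₁, det_fromBlocks_zero₂₁,
    det_fin_three]
  simp [Matrix.one_apply]
  ring

open Matrix in
theorem exists_aux {R : Type*} [CommRing R] {n : ℕ} (A : Matrix (Fin n) (Fin n) R)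
    (h : IsUnit A.det) : ∃ u : Fin n → R, ∀ i, ∑ j, A i j * u j = 1 := by
  refine ⟨A⁻¹ *ᵥ (fun _ => 1), fun i => ?_⟩
  have : A *ᵥ (A⁻¹ *ᵥ (fun _ => (1 : R))) = fun _ => 1 := by
    rw [mulVec_mulVec, mul_nonsing_inv _ h, one_mulVec]
  exact congrFun this i

theorem border_map_aux {R S : Type*} [CommRing R] [CommRing S] (f : R →+* S) {n : ℕ}
    (A : Matrix (Fin n) (Fin n) R) : f (border A).det = (border (A.map f)).det := by
  rw [RingHom.map_det]
  congr 1
  ext i j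
  simp only [border, RingHom.mapMatrix_apply, Matrix.map_apply, Matrix.of_apply]
  split_ifs <;> simp

theorem three_map_aux {R S : Type*} [CommRing R] [CommRing S] (f : R →+* S) {m n p : ℕ}
    (A : Matrix (Fin m) (Fin m) R) (B : Matrix (Fin n) (Fin n) R)
    (C : Matrix (Fin p) (Fin p) R) (a b c : R) : f (threeBlocks A B C a b c).det =
      (threeBlocks (A.map f) (B.map f) (C.map f) (f a) (f b) (f c)).det := by
  rw [RingHom.map_det]
  congr 1
  ext i j
  rcases i with i | i | i <;> rcases j with j | j | j <;> simp [threeBlocks]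

theorem det_map_aux {R S : Type*} [CommRing R] [CommRing S] (f : R →+* S) {n : ℕ}
    (A : Matrix (Fin n) (Fin n) R) : f A.det = (A.map f).det := by
  rw [RingHom.map_det]; rfl

open Polynomial in
theorem charmatrix_aux {R : Type*} [CommRing R] {n : ℕ} (A : Matrix (Fin n) (Fin n) R) :
    IsUnit ((-A).charmatrix.map (algebraMap R[X] (FractionRing R[X]))).det := by
  rw [← det_map_aux]
  exact IsLocalization.map_units (FractionRing R[X])
    (⟨_, (Matrix.charpoly_monic (-A)).mem_nonZeroDivisors⟩ : nonZeroDivisors R[X])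

open Polynomial in
theorem charmatrix_eval_aux {R : Type*} [CommRing R] {n : ℕ} (A : Matrix (Fin n) (Fin n) R) :
    (-A).charmatrix.map (evalRingHom (0 : R)) = A := by
  ext i j
  by_cases h : i = j
  · subst h; simp [Matrix.charmatrix_apply_eq]
  · simp [Matrix.charmatrix_apply_ne _ _ _ h]

open Polynomial in
theorem det_three_by_three_block {R : Type*} [CommRing R] {m n p : ℕ}
    (A : Matrix (Fin m) (Fin m) R) (B : Matrix (Fin n) (Fin n) R)
    (C : Matrix (Fin p) (Fin p) R) (a b c : R) :
    (threeBlocks A B C a b c).det =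
      A.det * B.det * C.det
        - a ^ 2 * (A.det * (border B).det * (border C).det)
        - b ^ 2 * ((border A).det * B.det * (border C).det)
        - c ^ 2 * ((border A).det * (border B).det * C.det)
        - 2 * a * b * c * ((border A).det * (border B).det * (border C).det) := by
  let f := algebraMap R[X] (FractionRing R[X])
  obtain ⟨u, hu⟩ := exists_aux _ (charmatrix_aux A)
  obtain ⟨v, hv⟩ := exists_aux _ (charmatrix_aux B)
  obtain ⟨w, hw⟩ := exists_aux _ (charmatrix_aux C)
  have key := det_three_aux _ _ _ (f (Polynomial.C a)) (f (Polynomial.C b)) (f (Polynomial.C c))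
    u hu v hv w hw
  have h2 : (2 : FractionRing R[X]) = f 2 := (map_ofNat f 2).symm
  rw [h2] at key
  simp only [← three_map_aux, ← border_map_aux, ← det_map_aux, f, ← map_mul, ← map_pow,
    ← map_sub] at key
  have key2 := IsLocalization.injective (FractionRing R[X]) (le_refl (nonZeroDivisors R[X])) key
  have key3 := congrArg (evalRingHom (0 : R)) key2
  simp only [map_mul, map_pow, map_sub, three_map_aux, border_map_aux, map_ofNat] at key3
  simp only [det_map_aux, charmatrix_eval_aux] at key3
  simpa using key3
end

section
/- Let h = (h(n))_{n≥1} be any sequence of integers with h(n) ≡ g(n) (mod 2) for all n ≥ 1, where g is the ruler function g(n) = ν₂(2n). Then for every n ≥ 1 the determinant of the Hankel matrix H_n^1(h) is odd, and in particular nonzero. -/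
lemma aux_descent (m : ℕ) : ∀ T R : Polynomial (ZMod 2), R.natDegree < m →
    (1 + Polynomial.X) * T * R + R ^ 2 + Polynomial.X * (1 + Polynomial.X) * T ^ 2 = 0 → R = 0 := by
  induction m with
  | zero => intro T R h; omega
  | succ m ih =>
    intro T R hd h
    by_contra hR
    have e : (1 + Polynomial.X : Polynomial (ZMod 2)) = Polynomial.X - Polynomial.C 1 := by
      rw [CharTwo.sub_eq_add, add_comm]; simp
    have hp : Prime (1 + Polynomial.X : Polynomial (ZMod 2)) := by
      rw [e]; exact Polynomial.prime_X_sub_C 1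
    have h2 : (2 : Polynomial (ZMod 2)) = 0 := CharTwo.two_eq_zero
    have h1 : (1 + Polynomial.X : Polynomial (ZMod 2)) ∣ R := by
      apply hp.dvd_of_dvd_pow (n := 2)
      exact ⟨-(T * R + Polynomial.X * T ^ 2), by linear_combination h⟩
    obtain ⟨S, rfl⟩ := h1
    have h3 : (1 + Polynomial.X) * T * S + (1 + Polynomial.X) * S ^ 2 + Polynomial.X * T ^ 2 = 0 := by
      apply mul_left_cancel₀ hp.ne_zero
      linear_combination h
    have h4 : (1 + Polynomial.X : Polynomial (ZMod 2)) ∣ T := by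
      apply hp.dvd_of_dvd_pow (n := 2)
      exact ⟨T * S + S ^ 2 + T ^ 2, by linear_combination -h3 + (1 + Polynomial.X) * T ^ 2 * h2 - T ^ 2 * h2 + h2 * (T ^ 2 - (1 + Polynomial.X) * T ^ 2 + (T * S + S ^ 2) * (0))⟩
    obtain ⟨U, rfl⟩ := h4
    have h5 : (1 + Polynomial.X) * U * S + S ^ 2 + Polynomial.X * (1 + Polynomial.X) * U ^ 2 = 0 := by
      apply mul_left_cancel₀ hp.ne_zero
      linear_combination h3
    have hS : S ≠ 0 := by rintro rfl; simp at hR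
    apply hS
    refine ih U S ?_ h5
    rw [Polynomial.natDegree_mul hp.ne_zero hS, e, Polynomial.natDegree_X_sub_C] at hd
    omega

lemma aux_sq (A : PowerSeries (ZMod 2)) (n : ℕ) :
    PowerSeries.coeff n (A ^ 2) = if 2 ∣ n then PowerSeries.coeff (n / 2) A else 0 := by
  rw [pow_two, PowerSeries.coeff_mul_eq_coeff_trunc_mul_trunc A A (Nat.lt_succ_self n), ← pow_two, ← Polynomial.coe_pow, Polynomial.coeff_coe]
  have := ZMod.expand_card (p := 2) (PowerSeries.trunc n.succ A)
  rw [← this, Polynomial.coeff_expand (by norm_num)]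
  split_ifs with h
  · rw [PowerSeries.coeff_trunc, if_pos]
    omega
  · rfl

lemma aux_even (k : ℕ) : ((ruler (2 * k + 1) : ℤ) : ZMod 2) = 1 := by
  unfold ruler
  rw [padicValNat.mul (by norm_num) (by omega), padicValNat.eq_zero_of_not_dvd (n := 2 * k + 1) (by omega)]
  simp

lemma aux_odd (k : ℕ) : ((ruler (2 * (k + 1)) : ℤ) : ZMod 2) = 1 + (ruler (k + 1) : ℤ) := by
  unfold ruler
  rw [padicValNat.mul (b := 2 * (k + 1)) (by norm_num) (by omega)]
  simp

noncomputable def auxA : PowerSeries (ZMod 2) := PowerSeries.mk fun k => ((ruler (k + 1) : ℤ) : ZMod 2)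

lemma auxA_eq : (1 + PowerSeries.X) * auxA = 1 + PowerSeries.X * (1 + PowerSeries.X) * auxA ^ 2 := by
  have h : auxA = PowerSeries.mk 1 + PowerSeries.X * auxA ^ 2 := by
    ext n
    rcases n with _ | n
    · have := aux_even 0
      simpa [auxA] using this
    · rw [map_add, PowerSeries.coeff_succ_X_mul, aux_sq]
      simp only [auxA, PowerSeries.coeff_mk, Pi.one_apply]
      split_ifs with hd
      · obtain ⟨m, rfl⟩ := hd
        rw [Nat.mul_div_cancel_left _ (by norm_num), ← aux_odd]
        rfl
      · obtain ⟨m, rfl⟩ : ∃ m, n = 2 * m + 1 := ⟨n / 2, by omega⟩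
        have := aux_even (m + 1)
        rw [add_zero]; exact this
  have h1 := PowerSeries.mk_one_mul_one_sub_eq_one (ZMod 2)
  have h2 : (2 : PowerSeries (ZMod 2)) = 0 := by
    have := congrArg (PowerSeries.C (R := ZMod 2)) (CharTwo.two_eq_zero (R := ZMod 2))
    rwa [map_ofNat, map_zero] at this
  linear_combination (1 + PowerSeries.X) * h + h1 + h2 * PowerSeries.X * PowerSeries.mk 1

lemma aux_det (n : ℕ) (hn : 1 ≤ n) :
    (Matrix.of fun i j : Fin n => ((ruler (1 + i + j) : ℤ) : ZMod 2)).det ≠ 0 := by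
  intro h0
  obtain ⟨v, hv, hv0⟩ := Matrix.exists_mulVec_eq_zero_iff.2 h0
  apply hv
  have h2 : (2 : PowerSeries (ZMod 2)) = 0 := by
    have := congrArg (PowerSeries.C (R := ZMod 2)) (CharTwo.two_eq_zero (R := ZMod 2))
    rwa [map_ofNat, map_zero] at this
  set R : Polynomial (ZMod 2) :=
    ∑ j : Fin n, Polynomial.C (v j) * Polynomial.X ^ (n - 1 - (j : ℕ)) with hR
  have hRd : R.natDegree ≤ n - 1 := by
    apply Polynomial.natDegree_sum_le_of_forall_le
    intro j _
    exact (Polynomial.natDegree_C_mul_X_pow_le _ _).trans (by omega)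
  have hcoef : ∀ i : Fin n, PowerSeries.coeff (n - 1 + i) ((R : PowerSeries (ZMod 2)) * auxA) = 0 := by
    intro i
    have := congrFun hv0 i
    simp only [Matrix.mulVec, dotProduct, Matrix.of_apply, Pi.zero_apply] at this
    rw [← this, hR, ← Polynomial.coeToPowerSeries.ringHom_apply, map_sum, Finset.sum_mul, map_sum]
    refine Finset.sum_congr rfl fun j _ => ?_
    have hj := j.2
    simp only [map_mul, map_pow, Polynomial.coeToPowerSeries.ringHom_apply, Polynomial.coe_C,
      Polynomial.coe_X, mul_assoc, PowerSeries.coeff_C_mul, PowerSeries.coeff_X_pow_mul']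
    rw [if_pos (by omega), auxA, PowerSeries.coeff_mk, mul_comm]
    congr 3
    omega
  set T := PowerSeries.trunc (n - 1) ((R : PowerSeries (ZMod 2)) * auxA) with hT
  have hTd : T.degree < (n - 1 : ℕ) := PowerSeries.degree_trunc_lt _ _
  have hdvd : (PowerSeries.X : PowerSeries (ZMod 2)) ^ (2 * n - 1) ∣ (R : PowerSeries (ZMod 2)) * auxA - T := by
    rw [PowerSeries.X_pow_dvd_iff]
    intro m hm
    rw [map_sub, Polynomial.coeff_coe, hT, PowerSeries.coeff_trunc]
    split_ifs with hlt
    · simp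
    · have := hcoef ⟨m - (n - 1), by omega⟩
      simp only [show n - 1 + (m - (n - 1)) = m by omega] at this
      rw [this, sub_zero]
  obtain ⟨E, hE⟩ := hdvd
  set N : Polynomial (ZMod 2) :=
    (1 + Polynomial.X) * T * R + R ^ 2 + Polynomial.X * (1 + Polynomial.X) * T ^ 2 with hN
  have hNdvd : (PowerSeries.X : PowerSeries (ZMod 2)) ^ (2 * n - 1) ∣ (N : PowerSeries (ZMod 2)) := by
    have e : (N : PowerSeries (ZMod 2)) = (1 + PowerSeries.X) * (T : PowerSeries (ZMod 2)) * (R : PowerSeries (ZMod 2)) + (R : PowerSeries (ZMod 2)) ^ 2 +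
        PowerSeries.X * (1 + PowerSeries.X) * (T : PowerSeries (ZMod 2)) ^ 2 := by
      simp [hN]
    rw [e]
    set x : PowerSeries (ZMod 2) := PowerSeries.X
    set r : PowerSeries (ZMod 2) := (R : PowerSeries (ZMod 2))
    set t : PowerSeries (ZMod 2) := (T : PowerSeries (ZMod 2))
    have ht : t = r * auxA - x ^ (2 * n - 1) * E := by rw [← hE]; ring
    generalize x ^ (2 * n - 1) = y at *
    have hA : (1 + x) * auxA = 1 + x * (1 + x) * auxA ^ 2 := auxA_eq
    refine ⟨-(1 + x) * E * r + x * (1 + x) * (-2 * r * auxA * E + y * E ^ 2), ?_⟩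
    rw [ht]
    linear_combination r ^ 2 * hA + r ^ 2 * h2 + h2 * (r ^ 2 * x * (1 + x) * auxA ^ 2)
  have hNd : N.degree < (2 * n - 1 : ℕ) := by
    refine Polynomial.degree_le_natDegree.trans_lt ?_
    rw [Nat.cast_lt]
    have h1X : (1 + Polynomial.X : Polynomial (ZMod 2)).natDegree ≤ 1 := by compute_degree
    have hR2 : (R ^ 2).natDegree ≤ 2 * (n - 1) := Polynomial.natDegree_pow_le_of_le 2 hRd
    by_cases hT0 : T = 0
    · rw [hN, hT0]
      have e : (1 + Polynomial.X) * 0 * R + R ^ 2 + Polynomial.X * (1 + Polynomial.X) * 0 ^ 2 = R ^ 2 := by ring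
      rw [e]
      omega
    · have hTn : T.natDegree < n - 1 := (Polynomial.natDegree_lt_iff_degree_lt hT0).2 hTd
      have hTn' : T.natDegree ≤ n - 2 := by omega
      have a1 := Polynomial.natDegree_mul_le_of_le (Polynomial.natDegree_mul_le_of_le h1X hTn') hRd
      have a2 := Polynomial.natDegree_mul_le_of_le
        (Polynomial.natDegree_mul_le_of_le (Polynomial.natDegree_X_le (R := ZMod 2)) h1X)
        (Polynomial.natDegree_pow_le_of_le 2 hTn')
      have a3 := Polynomial.natDegree_add_le_of_le (Polynomial.natDegree_add_le_of_le a1 hR2) a2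
      rw [← hN] at a3
      omega
  have hN0 : N = 0 := by
    ext m
    rw [Polynomial.coeff_zero]
    by_cases hm : m < 2 * n - 1
    · rw [← Polynomial.coeff_coe]
      exact PowerSeries.X_pow_dvd_iff.1 hNdvd m hm
    · apply Polynomial.coeff_eq_zero_of_degree_lt
      exact hNd.trans_le (by exact_mod_cast not_lt.1 hm)
  have hR0 : R = 0 := aux_descent _ T R (Nat.lt_succ_self _) hN0
  funext i
  have := congrArg (fun p => Polynomial.coeff p (n - 1 - (i : ℕ))) hR0
  simp only [hR, Polynomial.finsetSum_coeff, Polynomial.coeff_C_mul_X_pow, Polynomial.coeff_zero] at this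
  rw [Finset.sum_eq_single i] at this
  · simpa using this
  · intro j _ hji
    rw [if_neg]
    intro hh
    apply hji
    ext
    omega
  · simp

theorem det_hankel_odd_of_modEq_ruler (h : ℕ → ℤ)
    (hh : ∀ n, 1 ≤ n → h n ≡ ruler n [ZMOD 2]) (n : ℕ) (hn : 1 ≤ n) :
    Odd (hankelMatrix n 1 h).det ∧ (hankelMatrix n 1 h).det ≠ 0 := by
  have key : Odd (hankelMatrix n 1 h).det := by
    rw [← Int.not_even_iff_odd, even_iff_two_dvd]
    intro hd
    apply aux_det n hn
    have h1 := (ZMod.intCast_zmod_eq_zero_iff_dvd (hankelMatrix n 1 h).det 2).2 (by exact_mod_cast hd)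
    rw [← h1, ← eq_intCast (Int.castRingHom (ZMod 2)), RingHom.map_det]
    congr 1
    ext i j
    have := (ZMod.intCast_eq_intCast_iff _ _ 2).2 (hh (1 + i + j) (by omega))
    simp [hankelMatrix, this]
  refine ⟨key, fun h0 => ?_⟩
  rw [h0] at key
  simp at key
end

section
/- Let ξ, δ, ρ, ϑ be real numbers with 0 < δ ≤ ρ and ϑ ≥ 1. Suppose there exist a sequence of integers (p_n)_{n≥1}, a sequence of positive integers (q_n)_{n≥1}, and positive constants c₀, c₁, c₂ such that for all n ≥ 1: q_n < q_{n+1} ≤ c₀ q_n^ϑ, and c₁/q_n^{1+ρ} ≤ |ξ − p_n/q_n| ≤ c₂/q_n^{1+δ}. Then the irrationality exponent of ξ satisfies μ(ξ) ≤ (1+ρ)ϑ/δ; that is, for every real μ > (1+ρ)ϑ/δ, the inequality |ξ − p/q| < 1/q^μ has only finitely many solutions (p,q) with p an integer and q a positive integer. -/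
theorem irrationality_exponent_bound_of_rational_approximations
    (ξ δ ρ ϑ : ℝ) (hδ : 0 < δ) (hδρ : δ ≤ ρ) (hϑ : 1 ≤ ϑ)
    (p : ℕ → ℤ) (q : ℕ → ℕ) (c₀ c₁ c₂ : ℝ)
    (hc₀ : 0 < c₀) (hc₁ : 0 < c₁) (hc₂ : 0 < c₂)
    (hqpos : ∀ n, 1 ≤ n → 0 < q n)
    (hgrow : ∀ n, 1 ≤ n → (q n : ℝ) < (q (n + 1) : ℝ) ∧
      (q (n + 1) : ℝ) ≤ c₀ * (q n : ℝ) ^ ϑ)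
    (happrox : ∀ n, 1 ≤ n →
      c₁ / (q n : ℝ) ^ (1 + ρ) ≤ |ξ - (p n : ℝ) / (q n : ℝ)| ∧
      |ξ - (p n : ℝ) / (q n : ℝ)| ≤ c₂ / (q n : ℝ) ^ (1 + δ)) :
    ∀ μ : ℝ, (1 + ρ) * ϑ / δ < μ →
      {pq : ℤ × ℕ | 0 < pq.2 ∧
        |ξ - (pq.1 : ℝ) / (pq.2 : ℝ)| < 1 / (pq.2 : ℝ) ^ μ}.Finite := by
  intro μ hμ
  set E : ℝ := (1 + ρ) * ϑ / δ with hE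
  have hρ : 0 < ρ := lt_of_lt_of_le hδ hδρ
  have hϑ0 : 0 < ϑ := by linarith
  have hE0 : 0 < E := by positivity
  have hE1 : 1 + ϑ / δ ≤ E := by
    rw [hE, ← sub_nonneg]
    have : (1 + ρ) * ϑ / δ - (1 + ϑ / δ) = (ρ * ϑ - δ) / δ := by field_simp; ring
    rw [this]
    apply div_nonneg _ hδ.le
    nlinarith
  obtain ⟨K, hK⟩ : ∃ K : ℝ, K = c₀ * (2 * c₂) ^ (ϑ / δ) := ⟨_, rfl⟩
  have hK0 : 0 < K := by rw [hK]; positivity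
  have hge : ∀ n, 1 ≤ n → n ≤ q n := by
    intro n hn
    induction n, hn using Nat.le_induction with
    | base => exact hqpos 1 le_rfl
    | succ n hn ih =>
      have := (hgrow n hn).1
      have h2 : q n < q (n + 1) := by exact_mod_cast this
      omega
  have key : ∀ (a : ℤ) (b : ℕ), 0 < b → (q 1 : ℝ) ^ δ ≤ 2 * c₂ * (b : ℝ) →
      |ξ - (a : ℝ) / (b : ℝ)| < 1 / (b : ℝ) ^ μ →
      (b : ℝ) ^ (μ - E) < 2 * K + K ^ (1 + ρ) / c₁ := by
    intro a b hb hb1 hab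
    have hB1 : (1 : ℝ) ≤ b := by exact_mod_cast hb
    have hB : (0 : ℝ) < b := by linarith
    have hex : ∃ n, 1 ≤ n ∧ 2 * c₂ * (b : ℝ) < (q n : ℝ) ^ δ := by
      have h1 : Filter.Tendsto (fun n : ℕ => (n : ℝ) ^ δ) Filter.atTop Filter.atTop :=
        (tendsto_rpow_atTop hδ).comp tendsto_natCast_atTop_atTop
      obtain ⟨n, hn, hn1⟩ := ((h1.eventually_gt_atTop (2 * c₂ * (b : ℝ))).and
        (Filter.eventually_ge_atTop 1)).exists
      refine ⟨n, hn1, lt_of_lt_of_le hn ?_⟩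
      exact Real.rpow_le_rpow (by positivity) (by exact_mod_cast hge n hn1) hδ.le
    classical
    obtain ⟨m, hm1, hm, hmlast⟩ : ∃ m, 1 ≤ m ∧ 2 * c₂ * (b : ℝ) < (q (m + 1) : ℝ) ^ δ ∧
        (q m : ℝ) ^ δ ≤ 2 * c₂ * b := by
      have hs := Nat.find_spec hex
      have hmin := fun k => Nat.find_min hex (m := k)
      generalize Nat.find hex = n at hs hmin
      obtain ⟨hn1, hn⟩ := hs
      have hne : n ≠ 1 := by
        rintro rfl
        linarith
      obtain ⟨m, rfl⟩ : ∃ m, n = m + 1 := ⟨n - 1, by omega⟩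
      refine ⟨m, by omega, hn, ?_⟩
      have := hmin m (by omega)
      by_contra hcon
      exact this ⟨by omega, not_le.mp hcon⟩
    have hqm : (0 : ℝ) < q m := by exact_mod_cast hqpos m hm1
    have hqn : (0 : ℝ) < q (m + 1) := by exact_mod_cast hqpos (m + 1) (by omega)
    have hup : (q (m + 1) : ℝ) ≤ K * (b : ℝ) ^ (ϑ / δ) := by
      refine (hgrow m hm1).2.trans ?_
      rw [hK, mul_assoc, ← Real.mul_rpow (by positivity) hB.le]
      have h2 : (q m : ℝ) ^ ϑ = ((q m : ℝ) ^ δ) ^ (ϑ / δ) := by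
        rw [← Real.rpow_mul hqm.le]
        congr 1
        field_simp
      rw [h2]
      gcongr
    obtain ⟨hlo, hhi⟩ := happrox (m + 1) (by omega)
    have hBE : (0 : ℝ) < (b : ℝ) ^ E := by positivity
    have hBμ : (0 : ℝ) < (b : ℝ) ^ μ := by positivity
    rw [Real.rpow_sub hB, div_lt_iff₀ hBE]
    have hpos2 : 0 < K ^ (1 + ρ) / c₁ := by positivity
    generalize q (m + 1) = N at *
    generalize p (m + 1) = P at *
    by_cases heq : (a : ℝ) / b = (P : ℝ) / N
    · rw [heq] at hab
      have h1 := hlo.trans_lt hab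
      rw [div_lt_div_iff₀ (by positivity) hBμ, one_mul] at h1
      have h2 : (N : ℝ) ^ (1 + ρ) ≤ K ^ (1 + ρ) * (b : ℝ) ^ E := by
        calc (N : ℝ) ^ (1 + ρ) ≤ (K * (b : ℝ) ^ (ϑ / δ)) ^ (1 + ρ) := by gcongr
          _ = K ^ (1 + ρ) * (b : ℝ) ^ E := by
            rw [Real.mul_rpow hK0.le (by positivity), ← Real.rpow_mul hB.le, hE]
            congr 2
            field_simp
      have h3 : (b : ℝ) ^ μ < K ^ (1 + ρ) / c₁ * (b : ℝ) ^ E := by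
        rw [div_mul_eq_mul_div, lt_div_iff₀ hc₁]
        linarith
      nlinarith [mul_pos hK0 hBE]
    · have hne : a * N - P * b ≠ 0 := by
        intro h0
        apply heq
        rw [div_eq_div_iff hB.ne' hqn.ne']
        have : a * N = P * b := by omega
        exact_mod_cast this
      have h1 : (1 : ℝ) ≤ |(a : ℝ) * N - P * b| := by
        exact_mod_cast Int.one_le_abs hne
      have h2 : 1 / ((b : ℝ) * N) ≤ |(a : ℝ) / b - P / N| := by
        rw [div_sub_div _ _ hB.ne' hqn.ne', abs_div, abs_of_pos (mul_pos hB hqn)]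
        rw [mul_comm (b : ℝ) (P : ℝ)]
        gcongr
      have h3 : |(a : ℝ) / b - P / N| ≤ |ξ - (a : ℝ) / b| + |ξ - P / N| := by
        rw [abs_sub_comm ξ ((a : ℝ) / b)]
        exact abs_sub_le _ _ _
      have h4 : c₂ / (N : ℝ) ^ (1 + δ) ≤ 1 / (2 * ((b : ℝ) * N)) := by
        rw [Real.rpow_add hqn, Real.rpow_one, div_le_div_iff₀ (by positivity) (by positivity)]
        nlinarith
      have h5 : 1 / ((b : ℝ) * N) = 1 / (2 * ((b : ℝ) * N)) + 1 / (2 * ((b : ℝ) * N)) := by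
        field_simp; norm_num
      have h6 : 1 / (2 * ((b : ℝ) * N)) < 1 / (b : ℝ) ^ μ := by linarith
      have h7 : (b : ℝ) ^ μ < 2 * ((b : ℝ) * N) :=
        (one_div_lt_one_div (by positivity) hBμ).mp h6
      have h8 : (b : ℝ) * N ≤ K * (b : ℝ) ^ E := by
        calc (b : ℝ) * N ≤ b * (K * (b : ℝ) ^ (ϑ / δ)) := by gcongr
          _ = K * (b : ℝ) ^ (1 + ϑ / δ) := by
            rw [Real.rpow_add hB, Real.rpow_one]; ring
          _ ≤ K * (b : ℝ) ^ E := by gcongr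
      nlinarith [mul_pos hpos2 hBE]
  have ht : Filter.Tendsto (fun n : ℕ => (n : ℝ) ^ (μ - E)) Filter.atTop Filter.atTop :=
    (tendsto_rpow_atTop (by linarith)).comp tendsto_natCast_atTop_atTop
  have ht2 : Filter.Tendsto (fun n : ℕ => 2 * c₂ * (n : ℝ)) Filter.atTop Filter.atTop :=
    tendsto_natCast_atTop_atTop.const_mul_atTop (by positivity)
  obtain ⟨M, hM⟩ := Filter.eventually_atTop.mp
    ((ht.eventually_ge_atTop (2 * K + K ^ (1 + ρ) / c₁)).and
      (ht2.eventually_ge_atTop ((q 1 : ℝ) ^ δ)))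
  obtain ⟨L, hL⟩ := exists_nat_ge ((|ξ| + 1) * M)
  refine ((Set.finite_Icc (-(L : ℤ)) L).prod (Set.finite_Iic M)).subset ?_
  rintro ⟨a, b⟩ ⟨hb, hab⟩
  simp only at hb hab
  have hbM : b ≤ M := by
    by_contra hcon
    obtain ⟨h1, h2⟩ := hM b (by omega)
    exact absurd (key a b hb h2 hab) (not_lt.mpr h1)
  have hB1 : (1 : ℝ) ≤ b := by exact_mod_cast hb
  have hB : (0 : ℝ) < b := by linarith
  have h1 : 1 / (b : ℝ) ^ μ ≤ 1 := by
    rw [div_le_one (by positivity)]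
    exact Real.one_le_rpow hB1 (by linarith)
  have h2 : |(a : ℝ) / b| ≤ |ξ| + 1 := by
    have := abs_sub_abs_le_abs_sub ((a : ℝ) / b) ξ
    rw [abs_sub_comm] at this
    linarith
  rw [abs_div, abs_of_pos hB, div_le_iff₀ hB] at h2
  have h3 : |(a : ℝ)| ≤ L := by
    refine h2.trans (le_trans ?_ hL)
    have : (b : ℝ) ≤ M := by exact_mod_cast hbM
    gcongr
  have h4 : |a| ≤ (L : ℤ) := by exact_mod_cast h3
  exact ⟨abs_le.mp h4, hbM⟩
end

section
/- Let K ≥ 1 and n₀ be positive integers, and let S be the set of all integers of the form k·2^n where n ≥ n₀ and k is an odd integer with 2^{K−1}+1 ≤ k ≤ 2^K+1. Then for every a ∈ S there exists b ∈ S with a < b ≤ ((2^{K−1}+3)/(2^{K−1}+1))·a; in particular, if (a_j)_{j≥1} is the increasing enumeration of S, then a_{j+1} ≤ ((2^{K−1}+3)/(2^{K−1}+1))·a_j for every j ≥ 1. -/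
theorem exists_next_in_gap_set (K n₀ : ℕ) (hK : 1 ≤ K) (hn₀ : 1 ≤ n₀) :
    ∀ a ∈ {m : ℕ | ∃ n, n₀ ≤ n ∧ ∃ k, Odd k ∧
        2 ^ (K - 1) + 1 ≤ k ∧ k ≤ 2 ^ K + 1 ∧ m = k * 2 ^ n},
      ∃ b ∈ {m : ℕ | ∃ n, n₀ ≤ n ∧ ∃ k, Odd k ∧
        2 ^ (K - 1) + 1 ≤ k ∧ k ≤ 2 ^ K + 1 ∧ m = k * 2 ^ n},
        a < b ∧ (b : ℝ) ≤ ((2 ^ (K - 1) + 3 : ℝ) / (2 ^ (K - 1) + 1)) * (a : ℝ) := by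
  rintro a ⟨n, hn, k, hk, h1, h2, rfl⟩
  obtain ⟨L, rfl⟩ : ∃ L, K = L + 1 := ⟨K - 1, by omega⟩
  have hS : 2 ^ (L + 1) = 2 * 2 ^ L := by ring
  simp only [Nat.add_sub_cancel, hS] at *
  have key : ∀ c : ℕ, c * (2 ^ L + 1) ≤ (2 ^ L + 3) * k →
      ((c * 2 ^ n : ℕ) : ℝ) ≤ ((2 ^ L + 3 : ℝ) / (2 ^ L + 1)) * ((k * 2 ^ n : ℕ) : ℝ) := by
    intro c hc
    have hc' : (c : ℝ) * (2 ^ L + 1) ≤ (2 ^ L + 3) * k := by exact_mod_cast hc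
    rw [div_mul_eq_mul_div, le_div_iff₀ (by positivity)]
    push_cast
    have := mul_le_mul_of_nonneg_right hc' (by positivity : (0 : ℝ) ≤ 2 ^ n)
    linarith
  have hp : 0 < 2 ^ n := by positivity
  have hM : 0 < 2 ^ L := by positivity
  by_cases hlt : k < 2 * 2 ^ L + 1
  · have hk' := hk
    obtain ⟨j, hj⟩ := hk'
    refine ⟨(k + 2) * 2 ^ n, ⟨n, hn, k + 2, ⟨j + 1, by omega⟩, by omega, by omega, rfl⟩, ?_, ?_⟩
    · exact Nat.mul_lt_mul_of_pos_right (by omega) hp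
    · apply key
      nlinarith
  · have hke : k = 2 * 2 ^ L + 1 := by omega
    rcases Nat.eq_zero_or_pos L with h0 | h0
    · subst h0
      norm_num at hke
      subst hke
      refine ⟨6 * 2 ^ n, ⟨n + 1, by omega, 3, by decide, by norm_num, by norm_num, by ring⟩, ?_, ?_⟩
      · omega
      · apply key
        norm_num
    · refine ⟨(2 * 2 ^ L + 2) * 2 ^ n, ⟨n + 1, by omega, 2 ^ L + 1, ?_, le_rfl, by omega, by ring⟩,
        ?_, ?_⟩
      · exact Even.add_one ((Nat.even_pow' (by omega)).2 even_two)
      · exact Nat.mul_lt_mul_of_pos_right (by omega) hp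
      · apply key
        rw [hke]
        nlinarith
end
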